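/- arXiv:2511.02982 — 12 statements merged into one kernel-verified Lean document; each statement's English description precedes it below -/
import Mathlib

section
/- Let L be a finite modular lattice. An element of the lattice Sat(L) of saturated transfer systems on L (ordered by containment) is join-irreducible if and only if it equals ⌊x → y⌋ for some covering relation x ⋖ y in L; moreover, for every covering relation x ⋖ y the transfer system ⌊x → y⌋ is saturated and is a join-irreducible element of Sat(L). -/
/-- A transfer system on a lattice `L`: a reflexive, transitive binary relation refining `≤`
which is closed under restriction. -/
def IsTransferSystem {L : Type*} [Lattice L] (T : Set (L × L)) : Prop :=
  (∀ x : L, (x, x) ∈ T) ∧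
  (∀ x y z : L, (x, y) ∈ T → (y, z) ∈ T → (x, z) ∈ T) ∧
  (∀ x y : L, (x, y) ∈ T → x ≤ y) ∧
  (∀ x y z : L, (x, y) ∈ T → z ≤ y → (x ⊓ z, z) ∈ T)

/-- A saturated transfer system: a transfer system satisfying 2-out-of-3. -/
def IsSaturatedTS {L : Type*} [Lattice L] (T : Set (L × L)) : Prop :=
  IsTransferSystem T ∧ ∀ x y z : L, x ≤ y → y ≤ z → (x, z) ∈ T → (y, z) ∈ T

/-- A cotransfer system on a lattice `L`: a reflexive, transitive binary relation refining `≤`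
which is closed under corestriction. -/
def IsCotransferSystem {L : Type*} [Lattice L] (T : Set (L × L)) : Prop :=
  (∀ x : L, (x, x) ∈ T) ∧
  (∀ x y z : L, (x, y) ∈ T → (y, z) ∈ T → (x, z) ∈ T) ∧
  (∀ x y : L, (x, y) ∈ T → x ≤ y) ∧
  (∀ x y z : L, (x, y) ∈ T → x ≤ z → (z, y ⊔ z) ∈ T)

/-- `⌊x → y⌋`, the smallest transfer system containing the pair `(x, y)`. -/
def tsGen {L : Type*} [Lattice L] (x y : L) : Set (L × L) :=
  ⋂₀ {T | IsTransferSystem T ∧ (x, y) ∈ T}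

/-- `⌈x → y⌉`, the smallest cotransfer system containing the pair `(x, y)`. -/
def ctsGen {L : Type*} [Lattice L] (x y : L) : Set (L × L) :=
  ⋂₀ {T | IsCotransferSystem T ∧ (x, y) ∈ T}

/-- The smallest saturated transfer system containing a set `S` of pairs. -/
def satGen {L : Type*} [Lattice L] (S : Set (L × L)) : Set (L × L) :=
  ⋂₀ {T | IsSaturatedTS T ∧ S ⊆ T}

/-- The right lifting class `X^⧄` of a set `X` of pairs. -/
def rlc {L : Type*} [Lattice L] (X : Set (L × L)) : Set (L × L) :=
  {g | g.1 ≤ g.2 ∧ ∀ f ∈ X, f.1 ≤ g.1 → f.2 ≤ g.2 → f.2 ≤ g.1}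

/-- `T` is a join-irreducible element of the lattice `Sat(L)` of saturated transfer systems:
it is not the minimum (the diagonal), and whenever it is the join (in `Sat(L)`, i.e. the
saturated transfer system generated by the union) of two saturated transfer systems, it equals
one of them. -/
def JoinIrredSat {L : Type*} [Lattice L] (T : Set (L × L)) : Prop :=
  T ≠ {p : L × L | p.1 = p.2} ∧
  ∀ S₁ S₂ : Set (L × L), IsSaturatedTS S₁ → IsSaturatedTS S₂ →
    T = satGen (S₁ ∪ S₂) → T = S₁ ∨ T = S₂

/-- `T` is a meet-irreducible element of the lattice `Sat(L)` of saturated transfer systems: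
it is not the maximum (the full order relation), and whenever it is the meet (intersection)
of two saturated transfer systems, it equals one of them. -/
def MeetIrredSat {L : Type*} [Lattice L] (T : Set (L × L)) : Prop :=
  T ≠ {p : L × L | p.1 ≤ p.2} ∧
  ∀ S₁ S₂ : Set (L × L), IsSaturatedTS S₁ → IsSaturatedTS S₂ →
    T = S₁ ∩ S₂ → T = S₁ ∨ T = S₂

theorem isTransferSystem_tsGen_pairs {L : Type*} [Lattice L] (x y : L) :
    IsTransferSystem {p : L × L | p.1 = p.2 ∨ (p.2 ≤ y ∧ p.1 = x ⊓ p.2)} := by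
  refine ⟨fun a => Or.inl rfl, ?_, ?_, ?_⟩
  · rintro a b c ((rfl : a = b) | ⟨hb, rfl : a = x ⊓ b⟩) hbc
    · exact hbc
    · rcases hbc with (rfl : b = c) | ⟨hc, rfl : b = x ⊓ c⟩
      · exact Or.inr ⟨hb, rfl⟩
      · exact Or.inr ⟨hc, by simp⟩
  · rintro a b ((rfl : a = b) | ⟨_, rfl : a = x ⊓ b⟩)
    · exact le_rfl
    · exact inf_le_right
  · rintro a b z ((rfl : a = b) | ⟨hb, rfl : a = x ⊓ b⟩) hz
    · exact Or.inl (inf_eq_right.2 hz)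
    · exact Or.inr ⟨hz.trans hb, by simp [inf_assoc, inf_eq_right.2 hz]⟩

theorem tsGen_subset {L : Type*} [Lattice L] {x y : L} {T : Set (L × L)}
    (hT : IsTransferSystem T) (h : (x, y) ∈ T) : tsGen x y ⊆ T :=
  Set.sInter_subset_of_mem ⟨hT, h⟩

theorem mem_tsGen_self {L : Type*} [Lattice L] (x y : L) : (x, y) ∈ tsGen x y :=
  Set.mem_sInter.2 fun _ hT => hT.2

/-- Explicit description of the transfer system generated by a single pair. -/
theorem tsGen_eq {L : Type*} [Lattice L] {x y : L} (hxy : x ≤ y) :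
    tsGen x y = {p : L × L | p.1 = p.2 ∨ (p.2 ≤ y ∧ p.1 = x ⊓ p.2)} := by
  apply Set.Subset.antisymm
  · exact tsGen_subset (isTransferSystem_tsGen_pairs x y)
      (Or.inr ⟨le_rfl, (inf_eq_left.2 hxy).symm⟩)
  · rintro ⟨a, b⟩ hab T ⟨hT, hmem⟩
    rcases hab with (rfl : a = b) | ⟨hb, rfl : a = x ⊓ b⟩
    · exact hT.1 a
    · exact hT.2.2.2 x y b hmem hb

theorem isSaturatedTS_tsGen {L : Type*} [Lattice L] [IsModularLattice L] {x y : L}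
    (h : x ⋖ y) : IsSaturatedTS (tsGen x y) := by
  rw [tsGen_eq h.le]
  refine ⟨isTransferSystem_tsGen_pairs x y, ?_⟩
  rintro a b c hab hbc ((rfl : a = c) | ⟨hc, rfl : a = x ⊓ c⟩)
  · exact Or.inl (le_antisymm hbc hab)
  · by_cases hcx : c ≤ x
    · exact Or.inl (le_antisymm hbc ((le_inf hcx le_rfl).trans hab))
    · have hsup : x ⊔ c = y :=
        (h.eq_or_eq le_sup_left (sup_le h.le hc)).resolve_left fun e => hcx (sup_eq_left.1 e)
      have hcov : x ⊓ c ⋖ c := inf_covBy_of_covBy_sup_left (hsup.symm ▸ h)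
      rcases hcov.eq_or_eq hab hbc with rfl | rfl
      · exact Or.inr ⟨hc, rfl⟩
      · exact Or.inl rfl

theorem subset_satGen {L : Type*} [Lattice L] (S : Set (L × L)) : S ⊆ satGen S :=
  Set.subset_sInter fun _ hT => hT.2

theorem satGen_subset {L : Type*} [Lattice L] {S T : Set (L × L)}
    (hT : IsSaturatedTS T) (h : S ⊆ T) : satGen S ⊆ T :=
  Set.sInter_subset_of_mem ⟨hT, h⟩

theorem isSaturatedTS_le (L : Type*) [Lattice L] :
    IsSaturatedTS {p : L × L | p.1 ≤ p.2} :=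
  ⟨⟨fun _ => le_rfl, fun _ _ _ h₁ h₂ => le_trans h₁ h₂, fun _ _ h => h,
    fun _ _ _ _ _ => inf_le_right⟩, fun _ _ _ _ h _ => h⟩

theorem isSaturatedTS_diagonal (L : Type*) [Lattice L] :
    IsSaturatedTS {p : L × L | p.1 = p.2} :=
  ⟨⟨fun _ => rfl, fun _ _ _ h₁ h₂ => Eq.trans h₁ h₂, fun _ _ h => le_of_eq h,
    fun _ _ _ h hz => inf_eq_right.2 (hz.trans_eq h.symm)⟩,
    fun _ _ _ hab hbc h => le_antisymm hbc (h.symm.trans_le hab)⟩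

/-- The hypothesis `h` ensures that some saturated transfer system contains `S`. -/
theorem isSaturatedTS_satGen {L : Type*} [Lattice L] {S : Set (L × L)}
    (h : ∀ p ∈ S, p.1 ≤ p.2) : IsSaturatedTS (satGen S) := by
  refine ⟨⟨fun x T hT => hT.1.1.1 x, fun x y z hxy hyz T hT =>
    hT.1.1.2.1 x y z (hxy T hT) (hyz T hT), fun x y hxy => ?_, fun x y z hxy hz T hT =>
    hT.1.1.2.2.2 x y z (hxy T hT) hz⟩, fun x y z hxy hyz hxz T hT =>
    hT.1.2 x y z hxy hyz (hxz T hT)⟩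
  exact satGen_subset (isSaturatedTS_le L) h hxy

theorem IsSaturatedTS.diagonal_subset {L : Type*} [Lattice L] {T : Set (L × L)}
    (hT : IsSaturatedTS T) : {p : L × L | p.1 = p.2} ⊆ T := by
  rintro ⟨a, b⟩ (rfl : a = b)
  exact hT.1.1 a

/-- Removing the generating cover from `⌊x → y⌋` leaves a saturated transfer system. -/
theorem isSaturatedTS_tsGen_diff {L : Type*} [Lattice L] [IsModularLattice L] {x y : L}
    (h : x ⋖ y) : IsSaturatedTS (tsGen x y \ {(x, y)}) := by
  have hsat := isSaturatedTS_tsGen h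
  have hmem : ∀ a b, (a, b) ∈ tsGen x y → a = b ∨ (b ≤ y ∧ a = x ⊓ b) := fun a b hab => by
    rwa [tsGen_eq h.le] at hab
  have hle : x ⊓ y = x := inf_eq_left.2 h.le
  refine ⟨⟨fun a => ⟨hsat.1.1 a, ?_⟩, ?_, fun a b hab => hsat.1.2.2.1 a b hab.1, ?_⟩, ?_⟩
  · intro e
    obtain ⟨rfl, h'⟩ := Prod.mk.inj e
    exact h.ne h'
  · rintro a b c ⟨hab, hab'⟩ ⟨hbc, hbc'⟩
    refine ⟨hsat.1.2.1 a b c hab hbc, fun e => ?_⟩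
    obtain ⟨rfl, rfl⟩ := Prod.mk.inj e
    rcases h.eq_or_eq (hsat.1.2.2.1 _ _ hab) (hsat.1.2.2.1 _ _ hbc) with rfl | rfl
    · exact hbc' rfl
    · exact hab' rfl
  · rintro a b z ⟨hab, hab'⟩ hz
    refine ⟨hsat.1.2.2.2 a b z hab hz, fun e => ?_⟩
    obtain ⟨e₁, rfl⟩ := Prod.mk.inj e
    rcases hmem a b hab with rfl | ⟨hb, rfl⟩
    · exact h.ne (e₁.symm.trans (inf_eq_right.2 hz))
    · obtain rfl := le_antisymm hb hz
      exact hab' (by rw [hle]; rfl)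
  · rintro a b c hab hbc ⟨hac, hac'⟩
    refine ⟨hsat.2 a b c hab hbc hac, fun e => ?_⟩
    obtain ⟨rfl, rfl⟩ := Prod.mk.inj e
    rcases hmem a c hac with rfl | ⟨_, rfl⟩
    · exact h.lt.not_ge hab
    · exact hac' (by rw [hle]; rfl)

theorem joinIrredSat_tsGen {L : Type*} [Lattice L] [IsModularLattice L] {x y : L}
    (h : x ⋖ y) : JoinIrredSat (tsGen x y) := by
  refine ⟨fun e => h.ne (e ▸ mem_tsGen_self x y : (x, y) ∈ {p : L × L | p.1 = p.2}), ?_⟩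
  intro S₁ S₂ h₁ h₂ e
  have hsub : S₁ ∪ S₂ ⊆ tsGen x y := e ▸ subset_satGen (S₁ ∪ S₂)
  by_cases hxy : (x, y) ∈ S₁ ∪ S₂
  · rcases hxy with hxy | hxy
    · exact Or.inl ((tsGen_subset h₁.1 hxy).antisymm (Set.subset_union_left.trans hsub))
    · exact Or.inr ((tsGen_subset h₂.1 hxy).antisymm (Set.subset_union_right.trans hsub))
  · have hgen : satGen (S₁ ∪ S₂) ⊆ tsGen x y \ {(x, y)} :=
      satGen_subset (isSaturatedTS_tsGen_diff h) (Set.subset_sdiff_singleton hsub hxy)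
    exact absurd rfl (hgen (e ▸ mem_tsGen_self x y)).2

/-- In a finite lattice, a saturated transfer system is generated by its covering relations. -/
theorem IsSaturatedTS.eq_satGen_covBy {L : Type*} [Lattice L] [Finite L] {T : Set (L × L)}
    (hT : IsSaturatedTS T) : T = satGen {p | p ∈ T ∧ p.1 ⋖ p.2} := by
  refine Set.Subset.antisymm ?_ (satGen_subset hT fun p hp => hp.1)
  have hG : IsSaturatedTS (satGen {p | p ∈ T ∧ p.1 ⋖ p.2}) :=
    isSaturatedTS_satGen fun p hp => hp.2.le
  rintro ⟨a, b⟩ hab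
  induction a using WellFoundedGT.induction with
  | ind a ih =>
    have hle := hT.1.2.2.1 a b hab
    rcases hle.eq_or_lt with rfl | hlt
    · exact hG.1.1 a
    · obtain ⟨c, hac, hcb⟩ := exists_covBy_le_of_lt hlt
      have hacT : (a, c) ∈ T := by
        simpa [inf_eq_left.2 hac.le] using hT.1.2.2.2 a b c hab hcb
      exact hG.1.2.1 a c b (subset_satGen _ ⟨hacT, hac⟩)
        (ih c hac.lt (hT.2 a c b hac.le hcb hab))

/-- A join-irreducible saturated transfer system generated by a finite set of covering relations
is generated by one of them. -/
theorem JoinIrredSat.exists_eq_tsGen {L : Type*} [Lattice L] [IsModularLattice L]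
    {T : Set (L × L)} (hJ : JoinIrredSat T) {F : Set (L × L)} (hF : F.Finite)
    (hcov : ∀ p ∈ F, p.1 ⋖ p.2) (hTF : T = satGen F) :
    ∃ x y : L, x ⋖ y ∧ T = tsGen x y := by
  induction F, hF using Set.Finite.induction_on with
  | empty =>
    have hdiag := isSaturatedTS_diagonal L
    refine absurd (hTF.trans (Set.Subset.antisymm (satGen_subset hdiag (Set.empty_subset _)) ?_))
      hJ.1
    exact (isSaturatedTS_satGen fun p hp => hp.elim).diagonal_subset
  | @insert f F hf hF ih =>
    have hfc : f.1 ⋖ f.2 := hcov f (Set.mem_insert f F)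
    have hFc : ∀ p ∈ F, p.1 ⋖ p.2 := fun p hp => hcov p (Set.mem_insert_of_mem f hp)
    have hA := isSaturatedTS_satGen fun p hp => (hFc p hp).le
    have hB := isSaturatedTS_tsGen hfc
    have hG := isSaturatedTS_satGen fun p hp => (hcov p hp).le
    have hS : IsSaturatedTS (satGen (satGen F ∪ tsGen f.1 f.2)) := by
      refine isSaturatedTS_satGen ?_
      rintro p (hp | hp)
      · exact hA.1.2.2.1 _ _ hp
      · exact hB.1.2.2.1 _ _ hp
    have e : satGen (insert f F) = satGen (satGen F ∪ tsGen f.1 f.2) := by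
      apply Set.Subset.antisymm
      · refine satGen_subset hS (Set.insert_subset ?_ fun p hp => ?_)
        · exact subset_satGen _ (Or.inr (mem_tsGen_self f.1 f.2))
        · exact subset_satGen _ (Or.inl (subset_satGen _ hp))
      · refine satGen_subset hG (Set.union_subset ?_ ?_)
        · exact satGen_subset hG ((Set.subset_insert f F).trans (subset_satGen _))
        · exact tsGen_subset hG.1 (subset_satGen _ (Set.mem_insert f F))
    rcases hJ.2 _ _ hA hB (hTF.trans e) with h | h
    · exact ih hFc h
    · exact ⟨f.1, f.2, hfc, h⟩

/-- Theorem A (join-irreducibles): in a finite modular lattice `L`, a saturated transfer system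
is join-irreducible in `Sat(L)` iff it is `⌊x → y⌋` for a covering relation `x ⋖ y`; moreover
for every covering relation `x ⋖ y`, `⌊x → y⌋` is saturated and join-irreducible in `Sat(L)`. -/
theorem joinIrred_sat_iff (L : Type*) [Lattice L] [Finite L] [IsModularLattice L] :
    (∀ T : Set (L × L), IsSaturatedTS T →
      (JoinIrredSat T ↔ ∃ x y : L, x ⋖ y ∧ T = tsGen x y)) ∧
    (∀ x y : L, x ⋖ y → IsSaturatedTS (tsGen x y) ∧ JoinIrredSat (tsGen x y)) := by
  refine ⟨fun T hT => ⟨fun hJ => ?_, ?_⟩, fun x y h => ⟨isSaturatedTS_tsGen h, joinIrredSat_tsGen h⟩⟩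
  · exact hJ.exists_eq_tsGen (Set.toFinite _) (fun p hp => hp.2) hT.eq_satGen_covBy
  · rintro ⟨x, y, h, rfl⟩
    exact joinIrredSat_tsGen h
end

section
/- Let L be a finite modular lattice with minimum element ⊥. An element of the lattice Sat(L) of saturated transfer systems on L (ordered by containment) is meet-irreducible if and only if it equals ⌈⊥ → y⌉^⧄ for some y ∈ L with y ≠ ⊥; moreover, for every y ≠ ⊥ the relation ⌈⊥ → y⌉^⧄ is a saturated transfer system and is a meet-irreducible element of Sat(L). -/
theorem mem_ctsGen_bot_iff {L : Type*} [Lattice L] [OrderBot L] {y : L} {p : L × L} :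
    p ∈ ctsGen ⊥ y ↔ p.2 = p.1 ∨ p.2 = y ⊔ p.1 := by
  constructor
  · refine fun hp => hp {q | q.2 = q.1 ∨ q.2 = y ⊔ q.1} ⟨⟨?_, ?_, ?_, ?_⟩, ?_⟩
    · exact fun x => Or.inl rfl
    · intro a b c (hab : b = a ∨ b = y ⊔ a) (hbc : c = b ∨ c = y ⊔ b)
      obtain rfl | rfl := hab <;> obtain rfl | rfl := hbc <;> simp
    · rintro a b (rfl | rfl : b = a ∨ b = y ⊔ a) <;> simp
    · rintro a b c (rfl | rfl : b = a ∨ b = y ⊔ a) (h : _ ≤ c)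
      · simp [h]
      · right; simp [sup_assoc, h]
    · simp
  · obtain ⟨a, b⟩ := p
    rintro (rfl | rfl : b = a ∨ b = y ⊔ a) T ⟨hT, hy⟩
    · exact hT.1 _
    · exact hT.2.2.2 _ _ _ hy bot_le

theorem mem_rlc_ctsGen_bot_iff {L : Type*} [Lattice L] [OrderBot L] {y a b : L} :
    (a, b) ∈ rlc (ctsGen ⊥ y) ↔ a ≤ b ∧ (y ≤ b → y ≤ a) := by
  refine and_congr_right fun _ => ⟨fun h hy => ?_, ?_⟩
  · exact h (⊥, y) (mem_ctsGen_bot_iff.2 (by simp)) bot_le hy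
  · rintro h ⟨c, d⟩ hf (hc : c ≤ a) (hd : d ≤ b)
    obtain (rfl | rfl : d = c ∨ d = y ⊔ c) := mem_ctsGen_bot_iff.1 hf
    · exact hc
    · exact sup_le (h (le_sup_left.trans hd)) hc

theorem isSaturatedTS_rlc_ctsGen_bot {L : Type*} [Lattice L] [OrderBot L] (y : L) :
    IsSaturatedTS (rlc (ctsGen ⊥ y)) := by
  simp only [IsSaturatedTS, IsTransferSystem, mem_rlc_ctsGen_bot_iff]
  refine ⟨⟨fun x => ⟨le_rfl, id⟩, ?_, fun _ _ h => h.1, ?_⟩, ?_⟩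
  · exact fun a b c hab hbc => ⟨hab.1.trans hbc.1, fun h => hab.2 (hbc.2 h)⟩
  · exact fun a b c hab hcb => ⟨inf_le_right, fun h => le_inf (hab.2 (h.trans hcb)) h⟩
  · exact fun a b c hab hbc hac => ⟨hbc, fun h => (hac.2 h).trans hab⟩

theorem rlc_ctsGen_bot_ne_le {L : Type*} [Lattice L] [OrderBot L] {y : L} (hy : y ≠ ⊥) :
    rlc (ctsGen ⊥ y) ≠ {p : L × L | p.1 ≤ p.2} := by
  intro h
  have hmem : ((⊥ : L), y) ∈ rlc (ctsGen ⊥ y) := h ▸ (bot_le : (⊥ : L) ≤ y)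
  exact hy (le_bot_iff.1 ((mem_rlc_ctsGen_bot_iff.1 hmem).2 le_rfl))

/-- The relation `⌈⊥ → y⌉^⧄` is equal to or covered by the maximum of `Sat(L)`. -/
theorem IsSaturatedTS.eq_rlc_or_eq_le {L : Type*} [Lattice L] [OrderBot L] {y : L}
    {S : Set (L × L)} (hS : IsSaturatedTS S) (hsub : rlc (ctsGen ⊥ y) ⊆ S) :
    rlc (ctsGen ⊥ y) = S ∨ S = {p : L × L | p.1 ≤ p.2} := by
  obtain ⟨⟨-, htrans, hle, hres⟩, hsat⟩ := hS
  refine or_iff_not_imp_left.2 fun hne => ?_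
  obtain ⟨⟨a, b⟩, hab, hnot⟩ := Set.exists_of_ssubset (hsub.ssubset_of_ne hne)
  obtain ⟨hyb, hya⟩ : y ≤ b ∧ ¬ y ≤ a := by
    simpa [mem_rlc_ctsGen_bot_iff, hle _ _ hab] using hnot
  have hbot : (⊥, y) ∈ S := by
    refine htrans _ _ _ (hsub (mem_rlc_ctsGen_bot_iff.2 ⟨bot_le, fun h => ?_⟩))
      (hres _ _ _ hab hyb)
    exact absurd (h.trans inf_le_left) hya
  refine Set.Subset.antisymm (fun p hp => hle _ _ hp) fun ⟨c, d⟩ hcd => ?_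
  refine hsat ⊥ c d bot_le hcd ?_
  by_cases hyd : y ≤ d
  · exact htrans _ _ _ hbot (hsub (mem_rlc_ctsGen_bot_iff.2 ⟨hyd, fun _ => le_rfl⟩))
  · exact hsub (mem_rlc_ctsGen_bot_iff.2 ⟨bot_le, fun h => absurd h hyd⟩)

theorem meetIrredSat_rlc_ctsGen_bot {L : Type*} [Lattice L] [OrderBot L] {y : L} (hy : y ≠ ⊥) :
    MeetIrredSat (rlc (ctsGen ⊥ y)) := by
  refine ⟨rlc_ctsGen_bot_ne_le hy, fun S₁ S₂ h₁ h₂ h => ?_⟩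
  obtain h₁ | h₁ := h₁.eq_rlc_or_eq_le (h.le.trans Set.inter_subset_left)
  · exact Or.inl h₁
  obtain h₂ | h₂ := h₂.eq_rlc_or_eq_le (h.le.trans Set.inter_subset_right)
  · exact Or.inr h₂
  · exact absurd (by rw [h, h₁, h₂, Set.inter_self]) (rlc_ctsGen_bot_ne_le hy)

/-- A pair outside a saturated transfer system `T` is separated from `T` by some
`⌈⊥ → y⌉^⧄`. -/
theorem IsSaturatedTS.exists_subset_rlc_notMem {L : Type*} [Lattice L] [Finite L] [OrderBot L]
    {T : Set (L × L)} (hT : IsSaturatedTS T) {a b : L} (hab : a ≤ b) (h : (a, b) ∉ T) :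
    ∃ y : L, T ⊆ rlc (ctsGen ⊥ y) ∧ (a, b) ∉ rlc (ctsGen ⊥ y) := by
  obtain ⟨⟨hrefl, htrans, hle, hres⟩, hsat⟩ := hT
  obtain ⟨m, hm⟩ := (Set.toFinite {c | (c, b) ∈ T}).exists_minimal ⟨b, hrefl b⟩
  refine ⟨m, fun ⟨c, d⟩ hcd => ?_, fun hmem => ?_⟩
  · refine mem_rlc_ctsGen_bot_iff.2 ⟨hle _ _ hcd, fun hmd => ?_⟩
    exact (hm.2 (htrans _ _ _ (hres _ _ _ hcd hmd) hm.1) inf_le_right).trans inf_le_left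
  · have hma := (mem_rlc_ctsGen_bot_iff.1 hmem).2 (hle _ _ hm.1)
    exact h (hsat m a b hma hab hm.1)

theorem IsSaturatedTS.inter {L : Type*} [Lattice L] {S T : Set (L × L)}
    (hS : IsSaturatedTS S) (hT : IsSaturatedTS T) : IsSaturatedTS (S ∩ T) := by
  obtain ⟨⟨hS₁, hS₂, hS₃, hS₄⟩, hS₅⟩ := hS
  obtain ⟨⟨hT₁, hT₂, -, hT₄⟩, hT₅⟩ := hT
  exact ⟨⟨fun x => ⟨hS₁ x, hT₁ x⟩,
    fun x y z h h' => ⟨hS₂ x y z h.1 h'.1, hT₂ x y z h.2 h'.2⟩,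
    fun x y h => hS₃ x y h.1,
    fun x y z h h' => ⟨hS₄ x y z h.1 h', hT₄ x y z h.2 h'⟩⟩,
    fun x y z h h' h'' => ⟨hS₅ x y z h h' h''.1, hT₅ x y z h h' h''.2⟩⟩

theorem MeetIrredSat.exists_eq_of_eq_biInter {L ι : Type*} [Lattice L] {T : Set (L × L)}
    (hT : MeetIrredSat T) {R : ι → Set (L × L)} (hR : ∀ i, IsSaturatedTS (R i)) {s : Set ι}
    (hs : s.Finite) (h : T = {p : L × L | p.1 ≤ p.2} ∩ ⋂ i ∈ s, R i) : ∃ i ∈ s, T = R i := by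
  suffices IsSaturatedTS ({p : L × L | p.1 ≤ p.2} ∩ ⋂ i ∈ s, R i) ∧
      (T = {p : L × L | p.1 ≤ p.2} ∩ ⋂ i ∈ s, R i → ∃ i ∈ s, T = R i) from this.2 h
  clear h
  induction s, hs using Set.Finite.induction_on with
  | empty => simpa using ⟨isSaturatedTS_le L, fun h => hT.1 h⟩
  | @insert i s _ _ ih =>
    rw [Set.biInter_insert, Set.inter_left_comm]
    refine ⟨(hR i).inter ih.1, fun h => ?_⟩
    obtain h | h := hT.2 _ _ (hR i) ih.1 h
    · exact ⟨i, Set.mem_insert _ _, h⟩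
    · obtain ⟨j, hj, hTj⟩ := ih.2 h
      exact ⟨j, Set.mem_insert_of_mem _ hj, hTj⟩

theorem MeetIrredSat.exists_eq_rlc {L : Type*} [Lattice L] [Finite L] [OrderBot L]
    {T : Set (L × L)} (hirr : MeetIrredSat T) (hT : IsSaturatedTS T) :
    ∃ y : L, y ≠ ⊥ ∧ T = rlc (ctsGen ⊥ y) := by
  obtain ⟨y, -, rfl⟩ := hirr.exists_eq_of_eq_biInter isSaturatedTS_rlc_ctsGen_bot
      (Set.toFinite {y : L | T ⊆ rlc (ctsGen ⊥ y)}) <| by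
    refine Set.Subset.antisymm (fun p hp => ⟨hT.1.2.2.1 _ _ hp, Set.mem_iInter₂.2 fun y hy =>
      hy hp⟩) fun ⟨a, b⟩ ⟨hab, hmem⟩ => ?_
    by_contra hnot
    obtain ⟨y, hy, hy'⟩ := hT.exists_subset_rlc_notMem hab hnot
    exact hy' (Set.mem_iInter₂.1 hmem y hy)
  refine ⟨y, ?_, rfl⟩
  rintro rfl
  exact hirr.1 (Set.ext fun ⟨a, b⟩ => by simp [mem_rlc_ctsGen_bot_iff])


/-- Theorem A (meet-irreducibles): in a finite modular lattice `L` with minimum `⊥`, a saturated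
transfer system is meet-irreducible in `Sat(L)` iff it is `⌈⊥ → y⌉^⧄` for some `y ≠ ⊥`; moreover
for every `y ≠ ⊥`, `⌈⊥ → y⌉^⧄` is a saturated transfer system and is meet-irreducible. -/
theorem meetIrred_sat_iff (L : Type*) [Lattice L] [Finite L] [OrderBot L] [IsModularLattice L] :
    (∀ T : Set (L × L), IsSaturatedTS T →
      (MeetIrredSat T ↔ ∃ y : L, y ≠ ⊥ ∧ T = rlc (ctsGen ⊥ y))) ∧
    (∀ y : L, y ≠ ⊥ →
      IsSaturatedTS (rlc (ctsGen (⊥ : L) y)) ∧ MeetIrredSat (rlc (ctsGen (⊥ : L) y))) := by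
  exact ⟨fun T hT => ⟨fun h => h.exists_eq_rlc hT, fun ⟨_, hy, h⟩ =>
      h ▸ meetIrredSat_rlc_ctsGen_bot hy⟩,
    fun y hy => ⟨isSaturatedTS_rlc_ctsGen_bot y, meetIrredSat_rlc_ctsGen_bot hy⟩⟩
end

section
/- Let L be a lattice with minimum element ⊥, and let a, b, y ∈ L with a < b and y ≠ ⊥. Then ⌊a → b⌋ ⊆ ⌈⊥ → y⌉^⧄ if and only if y ≰ b or y ≤ a. -/
/-- The pairs `(u, v)` with `v = u` or `v = y ⊔ u` form a cotransfer system. -/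
lemma isCotransferSystem_eq_or_eq_sup {L : Type*} [Lattice L] (y : L) :
    IsCotransferSystem {p : L × L | p.2 = p.1 ∨ p.2 = y ⊔ p.1} := by
  refine ⟨fun x => Or.inl rfl, ?_, ?_, ?_⟩
  · intro x v z h₁ h₂
    obtain h₁ | h₁ : v = x ∨ v = y ⊔ x := h₁ <;>
      obtain h₂ | h₂ : z = v ∨ z = y ⊔ v := h₂ <;> simp [h₁, h₂]
  · intro x v h
    obtain h | h : v = x ∨ v = y ⊔ x := h <;> simp [h]
  · intro x v z h hz
    obtain h | h : v = x ∨ v = y ⊔ x := h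
    · exact Or.inl (sup_eq_right.2 (h.le.trans hz))
    · exact Or.inr (by simp [h, sup_assoc, sup_eq_right.2 hz])

/-- The pairs `(u, v)` with `u ≤ v` such that `y ≤ v` implies `y ≤ u` form a transfer system. -/
lemma isTransferSystem_le_imp_le {L : Type*} [Lattice L] (y : L) :
    IsTransferSystem {p : L × L | p.1 ≤ p.2 ∧ (y ≤ p.2 → y ≤ p.1)} := by
  refine ⟨fun x => ⟨le_rfl, id⟩, ?_, fun x z h => h.1, ?_⟩
  · rintro x v z ⟨h₁, h₂⟩ ⟨h₃, h₄⟩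
    exact ⟨h₁.trans h₃, fun h => h₂ (h₄ h)⟩
  · rintro x v z ⟨-, h⟩ hz
    exact ⟨inf_le_right, fun hyz => le_inf (h (hyz.trans hz)) hyz⟩

/-- `⌊a → b⌋ ⊆ ⌈⊥ → y⌉^⧄` iff `y ≰ b` or `y ≤ a`. -/
theorem tsGen_subset_rlc_iff (L : Type*) [Lattice L] [OrderBot L] (a b y : L)
    (hab : a < b) (hy : y ≠ ⊥) :
    tsGen a b ⊆ rlc (ctsGen (⊥ : L) y) ↔ (¬ y ≤ b ∨ y ≤ a) := by
  constructor
  · intro h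
    by_contra! hc
    exact hc.2 ((h (Set.mem_sInter.2 fun _ hT => hT.2)).2 (⊥, y)
      (Set.mem_sInter.2 fun _ hT => hT.2) bot_le hc.1)
  · intro h g hg
    obtain ⟨hle, hyg⟩ := hg _ ⟨isTransferSystem_le_imp_le y,
      ⟨hab.le, fun hyb => h.resolve_left (not_not_intro hyb)⟩⟩
    refine ⟨hle, fun f hf h₁ h₂ => ?_⟩
    rcases hf _ ⟨isCotransferSystem_eq_or_eq_sup y, Or.inr (by simp)⟩ with hu | hu
    · exact hu ▸ h₁
    · rw [hu] at h₂ ⊢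
      exact sup_le (hyg (le_sup_left.trans h₂)) h₁
end

section
/- The number of saturated transfer systems on the subgroup lattice of the elementary abelian group C_5^3 (the direct sum of three copies of the cyclic group of order 5) is exactly 13,784,538,270,571. -/
open Finset

/-! ### Packed vectors: many 64-bit fields in one natural number -/

/-- The `i`-th binary digit of `r`. -/
def bt (r i : ℕ) : ℕ := Nat.mod (Nat.shiftRight r i) 2

/-- `f 0 + ⋯ + f (n - 1)`. -/
def sumTo (f : ℕ → ℕ) : ℕ → ℕ
  | 0 => 0
  | n + 1 => Nat.add (sumTo f n) (f n)

/-- The fields `f 0, …, f 31`, placed `s` bits apart. -/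
def packRow (s : ℕ) (f : ℕ → ℕ) : ℕ := sumTo (fun r => Nat.shiftLeft (f r) (Nat.mul s r)) 32

/-- The fields `f 0, …, f (n - 1)`, placed 64 bits apart. -/
def pack (n : ℕ) (f : ℕ → ℕ) : ℕ := ∑ j ∈ range n, f j * 2 ^ (64 * j)

/-- Double the fields of `F` selected by the mask `M`. -/
def dbl (F M : ℕ) : ℕ := Nat.add F (Nat.land F M)

theorem sumTo_eq_sum (f : ℕ → ℕ) (n : ℕ) : sumTo f n = ∑ j ∈ range n, f j := by
  induction n with
  | zero => rfl
  | succ n ih => rw [sum_range_succ, ← ih]; rfl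

theorem packRow_eq_sum (s : ℕ) (f : ℕ → ℕ) :
    packRow s f = ∑ r ∈ range 32, f r * 2 ^ (s * r) := by
  rw [packRow, sumTo_eq_sum]
  exact sum_congr rfl fun r _ => Nat.shiftLeft_eq _ _

theorem bt_le_one (r i : ℕ) : bt r i ≤ 1 :=
  Nat.lt_succ_iff.mp (Nat.mod_lt _ (by norm_num))

theorem pack_congr (n : ℕ) {f g : ℕ → ℕ} (h : ∀ j, f j = g j) : pack n f = pack n g :=
  congrArg (pack n) (funext h)

theorem pack_succ (n : ℕ) (f : ℕ → ℕ) : pack (n + 1) f = 2 ^ (64 * n) * f n + pack n f := by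
  rw [pack, sum_range_succ, add_comm, mul_comm]; rfl

theorem pack_add (n : ℕ) (f g : ℕ → ℕ) :
    pack n f + pack n g = pack n fun j => f j + g j := by
  simp only [pack, ← sum_add_distrib, add_mul]

theorem pack_const_mul (n k : ℕ) (f : ℕ → ℕ) :
    k * pack n f = pack n fun j => k * f j := by
  simp only [pack, mul_sum, mul_assoc]

theorem pack_lt (n : ℕ) (f : ℕ → ℕ) (hf : ∀ j, f j < 2 ^ 64) : pack n f < 2 ^ (64 * n) := by
  induction n with
  | zero => simp [pack]
  | succ n ih =>
    rw [pack_succ, Nat.mul_succ, pow_add]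
    have h1 : f n + 1 ≤ 2 ^ 64 := hf n
    have h2 := Nat.mul_le_mul_left (2 ^ (64 * n)) h1
    rw [mul_add, mul_one] at h2
    exact lt_of_lt_of_le (Nat.add_lt_add_left ih _) h2

theorem land_two_pow_mul_add {k a b : ℕ} (x y : ℕ) (ha : a < 2 ^ k) (hb : b < 2 ^ k) :
    (2 ^ k * x + a) &&& (2 ^ k * y + b) = 2 ^ k * (x &&& y) + (a &&& b) := by
  apply Nat.eq_of_testBit_eq
  intro i
  have hab : a &&& b < 2 ^ k := lt_of_le_of_lt Nat.and_le_left ha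
  rw [Nat.testBit_and, Nat.testBit_two_pow_mul_add _ ha, Nat.testBit_two_pow_mul_add _ hb,
    Nat.testBit_two_pow_mul_add _ hab]
  split <;> simp

theorem pack_land (n : ℕ) (f g : ℕ → ℕ) (hf : ∀ j, f j < 2 ^ 64) (hg : ∀ j, g j < 2 ^ 64) :
    pack n f &&& pack n g = pack n fun j => f j &&& g j := by
  induction n with
  | zero => simp [pack]
  | succ n ih =>
    rw [pack_succ, pack_succ, pack_succ,
      land_two_pow_mul_add _ _ (pack_lt n f hf) (pack_lt n g hg), ih]

theorem dbl_pack (n : ℕ) (f s : ℕ → ℕ) (hf : ∀ j, f j < 2 ^ 64) (hs : ∀ j, s j ≤ 1) :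
    dbl (pack n f) (pack n fun j => (2 ^ 64 - 1) * s j) = pack n fun j => (1 + s j) * f j := by
  have hm : ∀ j, (2 ^ 64 - 1) * s j < 2 ^ 64 := fun j =>
    lt_of_le_of_lt (Nat.mul_le_mul_left _ (hs j)) (by norm_num)
  change pack n f + (pack n f &&& _) = _
  rw [pack_land n f _ hf hm, pack_add]
  refine pack_congr _ fun j => ?_
  rcases Nat.le_one_iff_eq_zero_or_eq_one.mp (hs j) with h | h
  · simp [h]
  · rw [h, mul_one, Nat.and_two_pow_sub_one_eq_mod, Nat.mod_eq_of_lt (hf j)]; ring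

theorem pack_mod (n : ℕ) (f : ℕ → ℕ) (h : ∑ j ∈ range n, f j < 2 ^ 64 - 1) :
    Nat.mod (pack n f) (2 ^ 64 - 1) = ∑ j ∈ range n, f j := by
  have key : pack n f ≡ ∑ j ∈ range n, f j [MOD 2 ^ 64 - 1] := by
    unfold pack
    refine Nat.ModEq.sum fun j _ => ?_
    have h1 : 2 ^ 64 ≡ 1 [MOD 2 ^ 64 - 1] := by decide
    simpa [pow_mul] using (h1.pow j).mul_left (f j)
  exact Eq.trans key (Nat.mod_eq_of_lt h)

theorem sum_range_mul (a b : ℕ) (g : ℕ → ℕ) :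
    ∑ j ∈ range (b * a), g j = ∑ i ∈ range a, ∑ k ∈ range b, g (b * i + k) := by
  induction a with
  | zero => simp
  | succ a ih => rw [Nat.mul_succ, sum_range_add, ih, sum_range_succ]

theorem sum_range_digits (g : ℕ → ℕ → ℕ → ℕ) :
    ∑ j ∈ range 32768, g (j % 32) (j / 32 % 32) (j / 1024) =
      ∑ r₄ ∈ range 32, ∑ r₃ ∈ range 32, ∑ r₂ ∈ range 32, g r₂ r₃ r₄ := by
  rw [show 32768 = 1024 * 32 from rfl, sum_range_mul]
  refine sum_congr rfl fun r₄ _ => ?_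
  rw [show 1024 = 32 * 32 from rfl, sum_range_mul]
  refine sum_congr rfl fun r₃ h₃ => sum_congr rfl fun r₂ h₂ => ?_
  rw [mem_range] at h₃ h₂
  congr 1 <;> omega

/-- A vector indexed by triples of digits whose entries are products of three factors. -/
theorem pack_prod (f g k : ℕ → ℕ) :
    packRow 64 f * packRow 2048 g * packRow 65536 k =
      pack 32768 fun j => f (j % 32) * g (j / 32 % 32) * k (j / 1024) := by
  have h : (pack 32768 fun j => f (j % 32) * g (j / 32 % 32) * k (j / 1024)) =
      ∑ r₄ ∈ range 32, ∑ r₃ ∈ range 32, ∑ r₂ ∈ range 32,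
        f r₂ * g r₃ * k r₄ * 2 ^ (64 * r₂ + 2048 * r₃ + 65536 * r₄) := by
    rw [← sum_range_digits fun r₂ r₃ r₄ => f r₂ * g r₃ * k r₄ *
      2 ^ (64 * r₂ + 2048 * r₃ + 65536 * r₄)]
    unfold pack
    refine sum_congr rfl fun j _ => ?_
    congr 2
    omega
  rw [h, packRow_eq_sum, packRow_eq_sum, packRow_eq_sum, sum_mul_sum, sum_mul_sum, sum_comm]
  simp_rw [sum_mul]
  refine sum_congr rfl fun r₄ _ => ?_
  rw [sum_comm]
  refine sum_congr rfl fun r₃ _ => sum_congr rfl fun r₂ _ => ?_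
  rw [pow_add, pow_add]
  ring

/-! ### Evaluating the weight sum with the first two rows fixed -/

/-- Fields indexed by `r < 32`: one where digit `i` of `r` is zero. -/
def offRow (s i : ℕ) : ℕ := packRow s fun r => Nat.sub 1 (bt r i)

/-- Fields indexed by `r < 32`: one where digit `i` of `r` is one. -/
def onRow (s i : ℕ) : ℕ := packRow s fun r => bt r i

/-- The abscissa in row `y` of the affine line `x = m y + c` over the field with five elements. -/
def abscissa (m c y : ℕ) : ℕ := Nat.mod (Nat.add (Nat.mul m y) c) 5

/-- The mask of the triples of rows 2, 3, 4 in which `x = m y + c` has no chosen point. -/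
def missMask (m c : ℕ) : ℕ :=
  Nat.mul 18446744073709551615 (Nat.mul (Nat.mul (offRow 64 (abscissa m c 2))
    (offRow 2048 (abscissa m c 3))) (offRow 65536 (abscissa m c 4)))

/-- The mask of the triples of rows 2, 3, 4 in which `x = m y + c` has exactly one chosen point. -/
def hitMask (m c : ℕ) : ℕ :=
  Nat.mul 18446744073709551615 (Nat.add (Nat.add
    (Nat.mul (Nat.mul (onRow 64 (abscissa m c 2)) (offRow 2048 (abscissa m c 3)))
      (offRow 65536 (abscissa m c 4)))
    (Nat.mul (Nat.mul (offRow 64 (abscissa m c 2)) (onRow 2048 (abscissa m c 3)))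
      (offRow 65536 (abscissa m c 4))))
    (Nat.mul (Nat.mul (offRow 64 (abscissa m c 2)) (offRow 2048 (abscissa m c 3)))
      (onRow 65536 (abscissa m c 4))))

/-- The number of ways to decide whether a line with `k` chosen points is selected: lines with at
most one chosen point are optional, all others are not selected. -/
def lineWeight : ℕ → ℕ
  | 0 => 2
  | 1 => 2
  | _ + 2 => 1

/-- Multiply every field by the weight of the line `x = m y + c`, which has `k` chosen points
outside rows 2, 3, 4. -/
def lineStep (m c : ℕ) : ℕ → ℕ → ℕ
  | 0, F => dbl F (Nat.add (missMask m c) (hitMask m c))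
  | 1, F => dbl F (missMask m c)
  | _ + 2, F => F

/-- Multiply every field by the weights of the lines `x = m y + c`, `c ∈ cs`, where `e` says
whether their common point at infinity is chosen. -/
def slopeStep (a b m e : ℕ) : List ℕ → ℕ → ℕ
  | [], F => F
  | c :: cs, F => slopeStep a b m e cs
      (lineStep m c (Nat.add (Nat.add (bt a (abscissa m c 0)) (bt b (abscissa m c 1))) e) F)

/-- Sum over the choices of points at infinity with slopes in a list, the vectors `F₀`, `F₁`, `F₂`
accounting for the cases of zero, one, or more points at infinity chosen so far. -/
def slopesSum (a b : ℕ) : List ℕ → ℕ → ℕ → ℕ → ℕ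
  | [], F₀, F₁, F₂ => Nat.add (Nat.add (Nat.mul 2 F₀) (Nat.mul 2 F₁)) F₂
  | m :: ms, F₀, F₁, F₂ => slopesSum a b ms (slopeStep a b m 0 [0, 1, 2, 3, 4] F₀)
      (Nat.add (slopeStep a b m 0 [0, 1, 2, 3, 4] F₁) (slopeStep a b m 1 [0, 1, 2, 3, 4] F₀))
      (Nat.add (slopeStep a b m 0 [0, 1, 2, 3, 4] F₂)
        (slopeStep a b m 1 [0, 1, 2, 3, 4] (Nat.add F₁ F₂)))

/-- The digit sum of `r < 32`. -/
def digitCount (r : ℕ) : ℕ := sumTo (bt r) 5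

/-- The weights of the five rows, `h` telling whether their common point is chosen. -/
def rowsVector (a b h : ℕ) : ℕ :=
  Nat.mul (Nat.mul (lineWeight (Nat.add (digitCount a) h)) (lineWeight (Nat.add (digitCount b) h)))
    (Nat.mul (Nat.mul (packRow 64 fun r => lineWeight (Nat.add (digitCount r) h))
      (packRow 2048 fun r => lineWeight (Nat.add (digitCount r) h)))
      (packRow 65536 fun r => lineWeight (Nat.add (digitCount r) h)))

/-- The total weight of the point sets whose rows 0 and 1 are given by the digits of `a`, `b`. -/
def fixedRowsSum (a b : ℕ) : ℕ :=
  Nat.mod (slopesSum a b [0, 1, 2, 3, 4] (rowsVector a b 0) (rowsVector a b 1) 0)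
    18446744073709551615

/-- The number of chosen points of `x = m y + c` in rows 2, 3, 4. -/
def tailCount (j m c : ℕ) : ℕ :=
  bt (j % 32) (abscissa m c 2) + bt (j / 32 % 32) (abscissa m c 3) + bt (j / 1024) (abscissa m c 4)

theorem lineWeight_eq (k : ℕ) : lineWeight k = 1 + if k ≤ 1 then 1 else 0 := by
  match k with
  | 0 => rfl
  | 1 => rfl
  | k + 2 => simp [lineWeight]

theorem lineWeight_le (k : ℕ) : lineWeight k ≤ 2 := by
  rw [lineWeight_eq]; split <;> norm_num

theorem missMask_eq (m c : ℕ) : missMask m c =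
    pack 32768 fun j => (2 ^ 64 - 1) * if tailCount j m c = 0 then 1 else 0 := by
  simp only [missMask, offRow, Nat.mul_eq]
  rw [pack_prod, pack_const_mul]
  refine pack_congr _ fun j => ?_
  rw [tailCount]
  generalize h₂ : bt (j % 32) (abscissa m c 2) = x
  generalize h₃ : bt (j / 32 % 32) (abscissa m c 3) = y
  generalize h₄ : bt (j / 1024) (abscissa m c 4) = z
  have hx : x ≤ 1 := h₂ ▸ bt_le_one _ _
  have hy : y ≤ 1 := h₃ ▸ bt_le_one _ _
  have hz : z ≤ 1 := h₄ ▸ bt_le_one _ _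
  interval_cases x <;> interval_cases y <;> interval_cases z <;> rfl

theorem hitMask_eq (m c : ℕ) : hitMask m c =
    pack 32768 fun j => (2 ^ 64 - 1) * if tailCount j m c = 1 then 1 else 0 := by
  simp only [hitMask, onRow, offRow, Nat.mul_eq, Nat.add_eq]
  rw [pack_prod, pack_prod, pack_prod, pack_add, pack_add, pack_const_mul]
  refine pack_congr _ fun j => ?_
  rw [tailCount]
  generalize h₂ : bt (j % 32) (abscissa m c 2) = x
  generalize h₃ : bt (j / 32 % 32) (abscissa m c 3) = y
  generalize h₄ : bt (j / 1024) (abscissa m c 4) = z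
  have hx : x ≤ 1 := h₂ ▸ bt_le_one _ _
  have hy : y ≤ 1 := h₃ ▸ bt_le_one _ _
  have hz : z ≤ 1 := h₄ ▸ bt_le_one _ _
  interval_cases x <;> interval_cases y <;> interval_cases z <;> rfl

theorem lineStep_pack (m c k : ℕ) (f : ℕ → ℕ) (hf : ∀ j, f j < 2 ^ 64) :
    lineStep m c k (pack 32768 f) = pack 32768 fun j => lineWeight (k + tailCount j m c) * f j := by
  match k with
  | 0 =>
    have h : Nat.add (missMask m c) (hitMask m c) =
        pack 32768 fun j => (2 ^ 64 - 1) * if tailCount j m c ≤ 1 then 1 else 0 := by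
      change missMask m c + hitMask m c = _
      rw [missMask_eq, hitMask_eq, pack_add]
      refine pack_congr _ fun j => ?_
      rcases h : tailCount j m c with _ | _ | _ <;> simp
    rw [lineStep, h, dbl_pack _ _ _ hf fun j => by split <;> norm_num]
    simp only [zero_add, lineWeight_eq]
  | 1 =>
    rw [lineStep, missMask_eq, dbl_pack _ _ _ hf fun j => by split <;> norm_num]
    refine pack_congr _ fun j => ?_
    rw [lineWeight_eq]
    simp only [add_le_iff_nonpos_right, nonpos_iff_eq_zero]
  | k + 2 =>
    rw [lineStep]
    refine pack_congr _ fun j => ?_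
    rw [lineWeight_eq, if_neg (by omega), add_zero, one_mul]

/-- The product of the weights of the lines `x = m y + c`, `c ∈ cs`, given all rows. -/
def slopeWeight (a b j m e : ℕ) : List ℕ → ℕ
  | [] => 1
  | c :: cs => slopeWeight a b j m e cs *
      lineWeight (bt a (abscissa m c 0) + bt b (abscissa m c 1) + e + tailCount j m c)

theorem slopeWeight_le (a b j m e : ℕ) (cs : List ℕ) :
    slopeWeight a b j m e cs ≤ 2 ^ cs.length := by
  induction cs with
  | nil => exact le_rfl
  | cons c cs ih => exact Nat.mul_le_mul ih (lineWeight_le _)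

theorem slopeStep_pack (a b m e B : ℕ) (cs : List ℕ) (f : ℕ → ℕ) (hf : ∀ j, f j ≤ B)
    (hB : 2 ^ cs.length * B < 2 ^ 64) :
    slopeStep a b m e cs (pack 32768 f) =
      pack 32768 fun j => slopeWeight a b j m e cs * f j := by
  induction cs generalizing f B with
  | nil => simp [slopeStep, slopeWeight]
  | cons c cs ih =>
    rw [List.length_cons, pow_succ, mul_assoc] at hB
    have h1 : B ≤ 2 ^ cs.length * (2 * B) :=
      (Nat.le_mul_of_pos_left B two_pos).trans (Nat.le_mul_of_pos_left _ (by positivity))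
    rw [slopeStep, lineStep_pack _ _ _ _ fun j => ((hf j).trans h1).trans_lt hB,
      ih (2 * B) _ (fun j => Nat.mul_le_mul (lineWeight_le _) (hf j)) hB]
    refine pack_congr _ fun j => ?_
    rw [slopeWeight, mul_assoc]
    rfl

/-- The scalar version of `slopesSum`. -/
def slopesWeight (a b j : ℕ) : List ℕ → ℕ → ℕ
  | [], s => lineWeight s
  | m :: ms, s => slopeWeight a b j m 0 [0, 1, 2, 3, 4] * slopesWeight a b j ms s +
      slopeWeight a b j m 1 [0, 1, 2, 3, 4] * slopesWeight a b j ms (s + 1)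

theorem slopesWeight_add_two (a b j : ℕ) (ms : List ℕ) (s : ℕ) :
    slopesWeight a b j ms (s + 2) = slopesWeight a b j ms 2 := by
  induction ms generalizing s with
  | nil => rfl
  | cons m ms ih =>
    rw [slopesWeight, slopesWeight, ih s, show s + 2 + 1 = s + 1 + 2 from rfl, ih (s + 1), ih 1]

theorem slopesWeight_le (a b j : ℕ) (ms : List ℕ) (s : ℕ) :
    slopesWeight a b j ms s ≤ 2 * 64 ^ ms.length := by
  induction ms generalizing s with
  | nil => exact lineWeight_le s
  | cons m ms ih =>
    have h0 := Nat.mul_le_mul (slopeWeight_le a b j m 0 [0, 1, 2, 3, 4]) (ih s)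
    have h1 := Nat.mul_le_mul (slopeWeight_le a b j m 1 [0, 1, 2, 3, 4]) (ih (s + 1))
    simp only [List.length_cons, List.length_nil] at h0 h1 ⊢
    rw [slopesWeight, pow_succ]
    omega

theorem slopesSum_pack (a b B : ℕ) (ms : List ℕ) (f₀ f₁ f₂ : ℕ → ℕ) (h₀ : ∀ j, f₀ j ≤ B)
    (h₁ : ∀ j, f₁ j ≤ B) (h₂ : ∀ j, f₂ j ≤ B) (hB : 96 ^ ms.length * B < 2 ^ 64) :
    slopesSum a b ms (pack 32768 f₀) (pack 32768 f₁) (pack 32768 f₂) = pack 32768 fun j =>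
      f₀ j * slopesWeight a b j ms 0 + f₁ j * slopesWeight a b j ms 1 +
        f₂ j * slopesWeight a b j ms 2 := by
  induction ms generalizing f₀ f₁ f₂ B with
  | nil =>
    simp only [slopesSum, Nat.mul_eq, Nat.add_eq]
    rw [pack_const_mul, pack_const_mul, pack_add, pack_add]
    refine pack_congr _ fun j => ?_
    simp only [slopesWeight, lineWeight]
    ring
  | cons m ms ih =>
    rw [List.length_cons, pow_succ, mul_assoc] at hB
    have hB' : 96 * B < 2 ^ 64 := (Nat.le_mul_of_pos_left _ (by positivity)).trans_lt hB
    have hw (j e : ℕ) : slopeWeight a b j m e [0, 1, 2, 3, 4] ≤ 32 := slopeWeight_le _ _ _ _ _ _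
    have h32 : 2 ^ [0, 1, 2, 3, 4].length * B < 2 ^ 64 := by
      simp only [List.length_cons, List.length_nil]; omega
    have h64 : 2 ^ [0, 1, 2, 3, 4].length * (2 * B) < 2 ^ 64 := by
      simp only [List.length_cons, List.length_nil]; omega
    have h₁₂ (j : ℕ) : f₁ j + f₂ j ≤ 2 * B := by have := h₁ j; have := h₂ j; omega
    rw [slopesSum, show Nat.add (pack 32768 f₁) (pack 32768 f₂) = _ from pack_add _ _ _,
      slopeStep_pack _ _ _ _ B _ _ h₀ h32, slopeStep_pack _ _ _ _ B _ _ h₁ h32,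
      slopeStep_pack _ _ _ _ B _ _ h₀ h32, slopeStep_pack _ _ _ _ B _ _ h₂ h32,
      slopeStep_pack _ _ _ _ (2 * B) _ _ h₁₂ h64]
    change slopesSum a b ms _ (pack _ _ + pack _ _) (pack _ _ + pack _ _) = _
    rw [pack_add, pack_add, ih (96 * B)]
    · refine pack_congr _ fun j => ?_
      simp only [slopesWeight, zero_add, Nat.reduceAdd, slopesWeight_add_two a b j ms 1]
      ring
    · exact fun j => (Nat.mul_le_mul (hw j 0) (h₀ j)).trans (by omega)
    · exact fun j => (Nat.add_le_add (Nat.mul_le_mul (hw j 0) (h₁ j))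
        (Nat.mul_le_mul (hw j 1) (h₀ j))).trans (by omega)
    · exact fun j => (Nat.add_le_add (Nat.mul_le_mul (hw j 0) (h₂ j))
        (Nat.mul_le_mul (hw j 1) (h₁₂ j))).trans (by omega)
    · exact hB

/-- The product of the weights of the five rows. -/
def rowsWeight (a b j h : ℕ) : ℕ :=
  lineWeight (digitCount a + h) * lineWeight (digitCount b + h) *
    (lineWeight (digitCount (j % 32) + h) * lineWeight (digitCount (j / 32 % 32) + h) *
      lineWeight (digitCount (j / 1024) + h))

theorem rowsWeight_le (a b j h : ℕ) : rowsWeight a b j h ≤ 32 := by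
  have hw (r : ℕ) : lineWeight (digitCount r + h) ≤ 2 := lineWeight_le _
  exact Nat.mul_le_mul (Nat.mul_le_mul (hw _) (hw _))
    (Nat.mul_le_mul (Nat.mul_le_mul (hw _) (hw _)) (hw _))

theorem rowsVector_eq (a b h : ℕ) :
    rowsVector a b h = pack 32768 fun j => rowsWeight a b j h := by
  change _ * _ * (packRow 64 _ * packRow 2048 _ * packRow 65536 _) = _
  rw [pack_prod, pack_const_mul]
  rfl

theorem fixedRowsSum_eq_sum_range (a b : ℕ) : fixedRowsSum a b = ∑ j ∈ range 32768,
    (rowsWeight a b j 0 * slopesWeight a b j [0, 1, 2, 3, 4] 0 +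
      rowsWeight a b j 1 * slopesWeight a b j [0, 1, 2, 3, 4] 1) := by
  have hz : (0 : ℕ) = pack 32768 fun _ => 0 := by simp [pack]
  rw [fixedRowsSum, rowsVector_eq, rowsVector_eq]
  nth_rw 3 [hz]
  rw [slopesSum_pack a b 32 [0, 1, 2, 3, 4] _ _ _
    (fun j => rowsWeight_le _ _ _ _) (fun j => rowsWeight_le _ _ _ _) (fun j => Nat.zero_le _)
    (by norm_num)]
  refine (pack_mod _ _ ?_).trans (sum_congr rfl fun j _ => by simp)
  have hb (j h s : ℕ) : rowsWeight a b j h * slopesWeight a b j [0, 1, 2, 3, 4] s ≤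
      32 * (2 * 64 ^ 5) := Nat.mul_le_mul (rowsWeight_le _ _ _ _) (slopesWeight_le a b j _ s)
  refine (sum_le_card_nsmul _ _ (2 * (32 * (2 * 64 ^ 5))) fun j _ => ?_).trans_lt ?_
  · have := hb j 0 0; have := hb j 1 1; omega
  · simp

/-- Representatives of the subsets of a five-element cyclic group up to translation, given by their
indicator digits, with the sizes of their orbits. -/
def translationOrbits : List (ℕ × ℕ) :=
  [(0, 1), (1, 5), (3, 5), (5, 5), (7, 5), (11, 5), (15, 5), (31, 1)]

/-- The total weight of the point sets with row 0 given by the digits of `a`. -/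
def firstRowSum (a : ℕ) : ℕ := (translationOrbits.map fun b => b.2 * fixedRowsSum a b.1).sum

theorem firstRowSum_0 : firstRowSum 0 = 5302604074610 := by decide +kernel

theorem firstRowSum_1 : firstRowSum 1 = 1242721529255 := by decide +kernel

theorem firstRowSum_3 : firstRowSum 3 = 173983057510 := by decide +kernel

theorem firstRowSum_5 : firstRowSum 5 = 173983057510 := by decide +kernel

theorem firstRowSum_7 : firstRowSum 7 = 45507118465 := by decide +kernel

theorem firstRowSum_11 : firstRowSum 11 = 45507118465 := by decide +kernel

theorem firstRowSum_15 : firstRowSum 15 = 13584208365 := by decide +kernel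

theorem firstRowSum_31 : firstRowSum 31 = 5503746095 := by decide +kernel

/-! ### The weight sum over all point sets of the projective plane of order five -/

/-- Coordinates for the points, and for the lines, of the projective plane of order five. As a
point, `inl (x, y)` is affine and `inr _` lies at infinity; as a line, `inl (m, c)` is
`x = m y + c`, `inr (inl c)` is `y = c` and `inr (inr ())` is the line at infinity. -/
abbrev PlaneCoord : Type := (ZMod 5 × ZMod 5) ⊕ ZMod 5 ⊕ Unit

/-- Incidence of points and lines in the projective plane of order five. -/
def Incident : PlaneCoord → PlaneCoord → Prop
  | .inl (x, y), .inl (m, c) => x = m * y + c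
  | .inl (_, y), .inr (.inl c) => y = c
  | .inl _, .inr (.inr _) => False
  | .inr (.inl n), .inl (m, _) => n = m
  | .inr (.inl _), .inr (.inl _) => False
  | .inr (.inr _), .inl _ => False
  | .inr (.inr _), .inr (.inl _) => True
  | .inr _, .inr (.inr _) => True

instance : DecidableRel Incident
  | .inl (x, y), .inl (m, c) => inferInstanceAs (Decidable (x = m * y + c))
  | .inl (_, y), .inr (.inl c) => inferInstanceAs (Decidable (y = c))
  | .inl _, .inr (.inr _) => inferInstanceAs (Decidable False)
  | .inr (.inl n), .inl (m, _) => inferInstanceAs (Decidable (n = m))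
  | .inr (.inl _), .inr (.inl _) => inferInstanceAs (Decidable False)
  | .inr (.inr _), .inl _ => inferInstanceAs (Decidable False)
  | .inr (.inr _), .inr (.inl _) => inferInstanceAs (Decidable True)
  | .inr (.inl _), .inr (.inr _) => inferInstanceAs (Decidable True)
  | .inr (.inr _), .inr (.inr _) => inferInstanceAs (Decidable True)

/-- The product of the weights of all lines for the point set with affine rows `A`, slopes `E` at
infinity, and `h` deciding about the common point of the rows. -/
def planeWeight (A : ZMod 5 → ZMod 5 → Bool) (E : ZMod 5 → Bool) (h : Bool) : ℕ :=
  (∏ m, ∏ c, lineWeight ((∑ y, (A y (m * y + c)).toNat) + (E m).toNat)) *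
    (∏ y, lineWeight ((∑ x, (A y x).toNat) + h.toNat)) *
    lineWeight ((∑ m, (E m).toNat) + h.toNat)

/-- The affine point set with the given rows. -/
def fiveRows (a b c d e : ZMod 5 → Bool) : ZMod 5 → ZMod 5 → Bool := ![a, b, c, d, e]

/-- The total weight of the point sets with rows 0 and 1 equal to `a` and `b`. -/
def twoRowsSum (a b : ZMod 5 → Bool) : ℕ :=
  ∑ c, ∑ d, ∑ e, ∑ E, ∑ h, planeWeight (fiveRows a b c d e) E h

/-- The shift of `a` by `s`. -/
def shiftSet (s : ZMod 5) (a : ZMod 5 → Bool) : ZMod 5 → Bool := fun x => a (x + s)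

/-- The subset of `ZMod 5` with indicator digits `r`. -/
def digits (r : ℕ) : ZMod 5 → Bool := fun x => decide (bt r x.val = 1)

theorem sum_shiftSet {M : Type*} [AddCommMonoid M] (s : ZMod 5) (g : (ZMod 5 → Bool) → M) :
    ∑ a, g (shiftSet s a) = ∑ a, g a :=
  (Equiv.arrowCongr (Equiv.addRight (-s)) (Equiv.refl Bool)).sum_comp g |>.symm ▸
    sum_congr rfl fun a _ => congrArg g (funext fun x => by simp [shiftSet])

theorem planeWeight_shiftSet (s u : ZMod 5) (A : ZMod 5 → ZMod 5 → Bool) (E : ZMod 5 → Bool)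
    (h : Bool) :
    planeWeight (fun y => shiftSet (s + u * y) (A y)) (shiftSet u E) h = planeWeight A E h := by
  unfold planeWeight
  congr 1
  · congr 1
    · refine Fintype.prod_equiv (Equiv.addRight u) _ _ fun m => ?_
      refine Fintype.prod_equiv (Equiv.addRight s) _ _ fun c => ?_
      simp only [shiftSet, Equiv.coe_addRight]
      congr 3
      funext y
      congr 2
      ring
    · refine prod_congr rfl fun y _ => ?_
      exact congrArg (fun k => lineWeight (k + h.toNat))
        (Equiv.sum_comp (Equiv.addRight (s + u * y)) fun x => (A y x).toNat)
  · exact congrArg (fun k => lineWeight (k + h.toNat))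
      (Equiv.sum_comp (Equiv.addRight u) fun x => (E x).toNat)

theorem twoRowsSum_shiftSet (s t : ZMod 5) (a b : ZMod 5 → Bool) :
    twoRowsSum (shiftSet s a) (shiftSet t b) = twoRowsSum a b := by
  unfold twoRowsSum
  rw [← sum_shiftSet (s + (t - s) * 2)]
  refine sum_congr rfl fun c _ => ?_
  rw [← sum_shiftSet (s + (t - s) * 3)]
  refine sum_congr rfl fun d _ => ?_
  rw [← sum_shiftSet (s + (t - s) * 4)]
  refine sum_congr rfl fun e _ => ?_
  rw [← sum_shiftSet (t - s)]
  refine sum_congr rfl fun E _ => sum_congr rfl fun h _ => ?_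
  rw [← planeWeight_shiftSet s (t - s) (fiveRows a b c d e)]
  congr 1
  funext y
  fin_cases y
  · exact congrArg (shiftSet · a) (by change s = s + (t - s) * 0; ring)
  · exact congrArg (shiftSet · b) (by change t = s + (t - s) * 1; ring)
  · rfl
  · rfl
  · rfl

theorem sum_eq_sum_digits {M : Type*} [AddCommMonoid M] (g : (ZMod 5 → Bool) → M) :
    ∑ a, g a = ∑ r ∈ range 32, g (digits r) := by
  rw [← Fin.sum_univ_eq_sum_range fun r => g (digits r)]
  refine (Fintype.sum_bijective (fun r : Fin 32 => digits r) ?_ _ _ fun _ => rfl).symm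
  decide +kernel

theorem toNat_digits (r : ℕ) (x : ZMod 5) : (digits r x).toNat = bt r x.val := by
  have h := bt_le_one r x.val
  unfold digits
  interval_cases hb : bt r x.val <;> rfl

theorem sum_zmod_five (f : ZMod 5 → ℕ) : ∑ x, f x = f 0 + f 1 + f 2 + f 3 + f 4 :=
  Fin.sum_univ_five f

theorem prod_zmod_five (f : ZMod 5 → ℕ) : ∏ x, f x = f 0 * f 1 * f 2 * f 3 * f 4 :=
  Fin.prod_univ_five f

theorem prod_zmod_val (f : ℕ → ℕ) : ∏ x : ZMod 5, f x.val = ∏ i ∈ range 5, f i :=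
  Fin.prod_univ_eq_prod_range f 5

theorem digitCount_eq_sum_range (r : ℕ) : digitCount r = ∑ i ∈ range 5, bt r i :=
  sumTo_eq_sum _ _

theorem slopesWeight_eq_sum (a b j s : ℕ) :
    slopesWeight a b j [0, 1, 2, 3, 4] s = ∑ E ∈ range 32, lineWeight (s + digitCount E) *
      ∏ m ∈ range 5, slopeWeight a b j m (bt E m) [0, 1, 2, 3, 4] := by
  have hb (r i : ℕ) : bt r i = r / 2 ^ i % 2 := by
    rw [← Nat.shiftRight_eq_div_pow]; rfl
  simp only [slopesWeight, digitCount_eq_sum_range, sum_range_succ, prod_range_succ, range_zero,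
    sum_empty, prod_empty, hb]
  norm_num
  ring

theorem slopeWeight_eq_prod (a b j m e : ℕ) : slopeWeight a b j m e [0, 1, 2, 3, 4] =
    ∏ c ∈ range 5, lineWeight (bt a (abscissa m c 0) + bt b (abscissa m c 1) + e +
      tailCount j m c) := by
  simp only [slopeWeight, prod_range_succ, range_zero, prod_empty]
  ring

theorem digitCount_eq (r : ℕ) : digitCount r = ∑ x, (digits r x).toNat := by
  simp only [toNat_digits]
  exact (digitCount_eq_sum_range r).trans (Fin.sum_univ_eq_sum_range (bt r) 5).symm

theorem val_mul_add (m c y : ZMod 5) : (m * y + c).val = abscissa m.val c.val y.val := by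
  revert m c y; decide +kernel

theorem planeWeight_digits (a b j E : ℕ) (h : Bool) :
    planeWeight (fiveRows (digits a) (digits b) (digits (j % 32)) (digits (j / 32 % 32))
      (digits (j / 1024))) (digits E) h =
      rowsWeight a b j h.toNat * (lineWeight (h.toNat + digitCount E) *
      ∏ m ∈ range 5, slopeWeight a b j m (bt E m) [0, 1, 2, 3, 4]) := by
  set A := fiveRows (digits a) (digits b) (digits (j % 32)) (digits (j / 32 % 32))
    (digits (j / 1024)) with hA
  have hs : (∏ m, ∏ c, lineWeight ((∑ y, (A y (m * y + c)).toNat) + (digits E m).toNat)) =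
      ∏ m ∈ range 5, slopeWeight a b j m (bt E m) [0, 1, 2, 3, 4] := by
    rw [← prod_zmod_val]
    refine prod_congr rfl fun m _ => ?_
    rw [slopeWeight_eq_prod, ← prod_zmod_val]
    refine prod_congr rfl fun c _ => ?_
    rw [sum_zmod_five]
    change lineWeight ((digits a _).toNat + (digits b _).toNat + (digits (j % 32) _).toNat +
      (digits (j / 32 % 32) _).toNat + (digits (j / 1024) _).toNat + (digits E _).toNat) = _
    simp only [toNat_digits, val_mul_add]
    rw [tailCount]
    congr 1
    change bt a (abscissa m.val c.val 0) + bt b (abscissa m.val c.val 1) +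
      bt _ (abscissa m.val c.val 2) + bt _ (abscissa m.val c.val 3) +
      bt _ (abscissa m.val c.val 4) + bt E m.val = _
    ring
  have hr : (∏ y, lineWeight ((∑ x, (A y x).toNat) + h.toNat)) = rowsWeight a b j h.toNat := by
    rw [prod_zmod_five]
    change lineWeight (∑ x, (digits a x).toNat + _) * lineWeight (∑ x, (digits b x).toNat + _) *
      lineWeight (∑ x, (digits _ x).toNat + _) * lineWeight (∑ x, (digits _ x).toNat + _) *
      lineWeight (∑ x, (digits _ x).toNat + _) = _
    simp only [← digitCount_eq, rowsWeight]
    ring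
  rw [planeWeight, hs, hr, ← digitCount_eq, add_comm h.toNat]
  ring

theorem twoRowsSum_digits (a b : ℕ) :
    twoRowsSum (digits a) (digits b) = fixedRowsSum a b := by
  rw [fixedRowsSum_eq_sum_range]
  let g (r₂ r₃ r₄ : ℕ) : ℕ := ∑ E ∈ range 32, ∑ h : Bool, planeWeight (fiveRows (digits a)
    (digits b) (digits r₂) (digits r₃) (digits r₄)) (digits E) h
  have hj (j : ℕ) : rowsWeight a b j 0 * slopesWeight a b j [0, 1, 2, 3, 4] 0 +
      rowsWeight a b j 1 * slopesWeight a b j [0, 1, 2, 3, 4] 1 =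
      g (j % 32) (j / 32 % 32) (j / 1024) := by
    simp only [g, planeWeight_digits, Fintype.sum_bool, Bool.toNat_true, Bool.toNat_false,
      sum_add_distrib, ← mul_sum, ← slopesWeight_eq_sum]
    exact Nat.add_comm _ _
  rw [sum_congr rfl fun j _ => hj j, sum_range_digits g, twoRowsSum]
  simp only [sum_eq_sum_digits]
  rw [sum_comm_cycle]
  exact sum_congr rfl fun _ _ => sum_comm

/-- The digits of the chosen representative of the orbit of `digits r` under shifts. -/
def orbitRep (r : ℕ) : ℕ :=
  [0, 1, 1, 3, 1, 5, 3, 7, 1, 5, 5, 11, 3, 11, 7, 15,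
    1, 3, 5, 7, 5, 11, 11, 15, 3, 7, 11, 15, 7, 15, 15, 31].getD r 0

theorem exists_shiftSet_orbitRep {r : ℕ} (hr : r < 32) :
    ∃ s, digits r = shiftSet s (digits (orbitRep r)) := by
  revert r; decide +kernel

theorem sum_twoRowsSum : ∑ a, ∑ b, twoRowsSum a b = 13784538268555 := by
  have h (r q : ℕ) (hr : r ∈ range 32) (hq : q ∈ range 32) :
      twoRowsSum (digits r) (digits q) = fixedRowsSum (orbitRep r) (orbitRep q) := by
    obtain ⟨s, hs⟩ := exists_shiftSet_orbitRep (mem_range.mp hr)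
    obtain ⟨t, ht⟩ := exists_shiftSet_orbitRep (mem_range.mp hq)
    rw [hs, ht, twoRowsSum_shiftSet, twoRowsSum_digits]
  have ho (g : ℕ → ℕ) :
      ∑ r ∈ range 32, g (orbitRep r) = (translationOrbits.map fun b => b.2 * g b.1).sum := by
    simp [sum_range_succ, orbitRep, translationOrbits]
    ring
  simp only [sum_eq_sum_digits]
  rw [sum_congr rfl fun r hr => sum_congr rfl fun q hq => h r q hr hq]
  simp only [ho (fixedRowsSum _)]
  rw [ho fun a => (translationOrbits.map fun b => b.2 * fixedRowsSum a b.1).sum]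
  change (translationOrbits.map fun b => b.2 * firstRowSum b.1).sum = _
  simp only [translationOrbits, List.map_cons, List.map_nil, firstRowSum_0, firstRowSum_1,
    firstRowSum_3, firstRowSum_5, firstRowSum_7, firstRowSum_11, firstRowSum_15, firstRowSum_31]
  norm_num

/-- The number of points of `D` on the line `ℓ`. -/
def pointCount (D : PlaneCoord → Bool) (ℓ : PlaneCoord) : ℕ :=
  ∑ p, if Incident p ℓ then (D p).toNat else 0

theorem pointCount_eq (A : ZMod 5 → ZMod 5 → Bool) (E : ZMod 5 → Bool) (h : Bool)
    (ℓ : PlaneCoord) :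
    pointCount (Sum.elim (fun p => A p.2 p.1) (Sum.elim E fun _ => h)) ℓ =
      (∑ y, ∑ x, if Incident (.inl (x, y)) ℓ then (A y x).toNat else 0) +
      ((∑ n, if Incident (.inr (.inl n)) ℓ then (E n).toNat else 0) +
        if Incident (.inr (.inr ())) ℓ then h.toNat else 0) := by
  rw [pointCount, Fintype.sum_sum_type, Fintype.sum_sum_type, Fintype.sum_prod_type_right]
  simp only [Sum.elim_inl, Sum.elim_inr, univ_unique, sum_singleton]

theorem prod_lineWeight_pointCount (A : ZMod 5 → ZMod 5 → Bool) (E : ZMod 5 → Bool) (h : Bool) :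
    ∏ ℓ, lineWeight (pointCount (Sum.elim (fun p => A p.2 p.1) (Sum.elim E fun _ => h)) ℓ) =
      planeWeight A E h := by
  simp only [pointCount_eq]
  rw [Fintype.prod_sum_type, Fintype.prod_sum_type, Fintype.prod_prod_type, planeWeight,
    ← mul_assoc, univ_unique (α := Unit), prod_singleton]
  refine congrArg₂ _ (congrArg₂ _ ?_ ?_) ?_
  · refine prod_congr rfl fun m _ => prod_congr rfl fun c _ => congrArg lineWeight ?_
    change (∑ y, ∑ x, if x = m * y + c then (A y x).toNat else 0) +
      ((∑ n, if n = m then (E n).toNat else 0) + if False then h.toNat else 0) = _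
    simp
  · refine prod_congr rfl fun c _ => congrArg lineWeight ?_
    change (∑ y, ∑ x, if y = c then (A y x).toNat else 0) +
      ((∑ n : ZMod 5, if False then (E n).toNat else 0) + if True then h.toNat else 0) = _
    simp
  · refine congrArg lineWeight ?_
    change (∑ y, ∑ x, if False then (A y x).toNat else 0) +
      ((∑ n : ZMod 5, if True then (E n).toNat else 0) + if True then h.toNat else 0) = _
    simp

/-- A set of points of the plane is given by its affine rows, its slopes at infinity, and the common
point of the rows. -/
def rowsEquiv : (ZMod 5 → Bool) × (ZMod 5 → Bool) × (ZMod 5 → Bool) × (ZMod 5 → Bool) ×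
    (ZMod 5 → Bool) × (ZMod 5 → Bool) × Bool ≃ (PlaneCoord → Bool) where
  toFun t := Sum.elim (fun p => fiveRows t.1 t.2.1 t.2.2.1 t.2.2.2.1 t.2.2.2.2.1 p.2 p.1)
    (Sum.elim t.2.2.2.2.2.1 fun _ => t.2.2.2.2.2.2)
  invFun D := (fun x => D (.inl (x, 0)), fun x => D (.inl (x, 1)), fun x => D (.inl (x, 2)),
    fun x => D (.inl (x, 3)), fun x => D (.inl (x, 4)), fun n => D (.inr (.inl n)),
    D (.inr (.inr ())))
  left_inv _ := rfl
  right_inv D := by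
    funext p
    obtain ⟨x, y⟩ | n | _ := p
    · fin_cases y <;> rfl
    · rfl
    · rfl

theorem sum_prod_lineWeight :
    ∑ D, ∏ ℓ, lineWeight (pointCount D ℓ) = 13784538268555 := by
  rw [← sum_twoRowsSum, ← Equiv.sum_comp rowsEquiv]
  simp only [Fintype.sum_prod_type, twoRowsSum, ← prod_lineWeight_pointCount]
  rfl

/-! ### Saturated transfer systems on the lattice of flats of the plane -/

theorem exists_incident_and_not {p q : PlaneCoord} (h : p ≠ q) :
    ∃ ℓ, Incident p ℓ ∧ ¬Incident q ℓ := by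
  revert p q; decide +kernel

theorem exists_incident_both_lines (ℓ m : PlaneCoord) : ∃ p, Incident p ℓ ∧ Incident p m := by
  revert ℓ m; decide +kernel

theorem exists_incident_both_points (p q : PlaneCoord) : ∃ ℓ, Incident p ℓ ∧ Incident q ℓ := by
  revert p q; decide +kernel

theorem eq_of_incident {p q ℓ m : PlaneCoord} (hℓm : ℓ ≠ m) (hp : Incident p ℓ)
    (hp' : Incident p m) (hq : Incident q ℓ) (hq' : Incident q m) : p = q := by
  have h : ∀ ℓ m : PlaneCoord, ℓ ≠ m →
      (univ.filter fun p => Incident p ℓ ∧ Incident p m).card ≤ 1 := by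
    decide +kernel
  exact card_le_one.mp (h ℓ m hℓm) p (by simp [hp, hp']) q (by simp [hq, hq'])

theorem exists_incident_ne (p ℓ : PlaneCoord) : ∃ m, m ≠ ℓ ∧ Incident p m := by
  revert p ℓ; decide +kernel

theorem exists_not_incident (p : PlaneCoord) : ∃ ℓ, ¬Incident p ℓ := by
  revert p; decide +kernel

theorem exists_incident (ℓ : PlaneCoord) : ∃ p, Incident p ℓ :=
  (exists_incident_both_lines ℓ ℓ).imp fun _ => And.left

/-- The flats of the projective plane of order five. -/
inductive Flat : Type
  | bot
  | pt (p : PlaneCoord)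
  | ln (ℓ : PlaneCoord)
  | top

namespace Flat

/-- Containment of flats. -/
protected def Le : Flat → Flat → Prop
  | bot, _ => True
  | pt p, pt q => p = q
  | pt p, ln ℓ => Incident p ℓ
  | ln ℓ, ln m => ℓ = m
  | _, top => True
  | _, _ => False

instance : LE Flat := ⟨Flat.Le⟩

@[simp] theorem bot_le (x : Flat) : bot ≤ x := by cases x <;> trivial
@[simp] theorem le_top (x : Flat) : x ≤ top := by cases x <;> trivial
@[simp] theorem pt_le_pt {p q : PlaneCoord} : pt p ≤ pt q ↔ p = q := Iff.rfl
@[simp] theorem pt_le_ln {p ℓ : PlaneCoord} : pt p ≤ ln ℓ ↔ Incident p ℓ := Iff.rfl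
@[simp] theorem ln_le_ln {ℓ m : PlaneCoord} : ln ℓ ≤ ln m ↔ ℓ = m := Iff.rfl
@[simp] theorem not_pt_le_bot {p : PlaneCoord} : ¬pt p ≤ bot := id
@[simp] theorem not_ln_le_bot {ℓ : PlaneCoord} : ¬ln ℓ ≤ bot := id
@[simp] theorem not_ln_le_pt {ℓ p : PlaneCoord} : ¬ln ℓ ≤ pt p := id
@[simp] theorem not_top_le_bot : ¬top ≤ bot := id
@[simp] theorem not_top_le_pt {p : PlaneCoord} : ¬top ≤ pt p := id
@[simp] theorem not_top_le_ln {ℓ : PlaneCoord} : ¬top ≤ ln ℓ := id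

instance : PartialOrder Flat where
  le_refl x := by cases x <;> simp
  le_trans x y z h₁ h₂ := by cases x <;> cases y <;> cases z <;> simp_all
  le_antisymm x y h₁ h₂ := by cases x <;> cases y <;> simp_all

open Classical in
/-- The intersection of two flats. -/
protected noncomputable def inter : Flat → Flat → Flat
  | bot, _ => bot
  | _, bot => bot
  | top, x => x
  | x, top => x
  | pt p, pt q => if p = q then pt p else bot
  | pt p, ln ℓ => if Incident p ℓ then pt p else bot
  | ln ℓ, pt p => if Incident p ℓ then pt p else bot
  | ln ℓ, ln m => if ℓ = m then ln ℓ else pt (exists_incident_both_lines ℓ m).choose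

theorem inter_le (x y : Flat) : x.inter y ≤ x ∧ x.inter y ≤ y := by
  cases x <;> cases y <;> simp only [Flat.inter] <;> (try split_ifs) <;>
    simp_all [-Sum.forall, (exists_incident_both_lines _ _).choose_spec]

theorem le_inter {x y z : Flat} (hy : x ≤ y) (hz : x ≤ z) : x ≤ y.inter z := by
  cases y <;> cases z <;> cases x <;> simp only [Flat.inter] <;> (try split_ifs) <;> simp_all
  exact eq_of_incident ‹_› hy hz (exists_incident_both_lines _ _).choose_spec.1
    (exists_incident_both_lines _ _).choose_spec.2

noncomputable instance : SemilatticeInf Flat where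
  inf := Flat.inter
  inf_le_left x y := (inter_le x y).1
  inf_le_right x y := (inter_le x y).2
  le_inf _ _ _ := le_inter

theorem pt_inf_pt {p q : PlaneCoord} (h : p ≠ q) : pt p ⊓ pt q = bot := if_neg h
theorem pt_inf_ln {p ℓ : PlaneCoord} (h : ¬Incident p ℓ) : pt p ⊓ ln ℓ = bot := if_neg h
theorem ln_inf_pt {p ℓ : PlaneCoord} (h : ¬Incident p ℓ) : ln ℓ ⊓ pt p = bot := if_neg h

theorem ln_inf_ln {p ℓ m : PlaneCoord} (h : ℓ ≠ m) (hℓ : Incident p ℓ) (hm : Incident p m) :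
    ln ℓ ⊓ ln m = pt p := by
  have hc := (exists_incident_both_lines ℓ m).choose_spec
  exact (if_neg h).trans (congrArg pt (eq_of_incident h hc.1 hc.2 hℓ hm))

/-- Saturated transfer systems on the flats. -/
structure IsSat (T : Flat → Flat → Prop) : Prop where
  refl : ∀ x, T x x
  trans : ∀ {x y z}, T x y → T y z → T x z
  le : ∀ {x y}, T x y → x ≤ y
  restrict : ∀ {x y z}, T x y → z ≤ y → T (x ⊓ z) z
  sat : ∀ {x y z}, x ≤ y → y ≤ z → T x z → T y z

/-- The triples of point and line sets classifying saturated transfer systems: `D` is the set of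
points not related to the bottom, `S` is the set of lines related to some point, and `C` is the set
of lines related to the top. -/
structure Admissible (D S C : PlaneCoord → Bool) : Prop where
  eq_of_mem : ∀ {ℓ p q}, S ℓ → Incident p ℓ → Incident q ℓ → D p → D q → p = q
  incident : ∀ {ℓ p}, C ℓ → D p → Incident p ℓ
  mem_of_ne : ∀ {ℓ m}, C ℓ → m ≠ ℓ → S m
  pencil : ∀ {ℓ m p}, C ℓ → S ℓ → Incident p ℓ → (∀ q, D q → q = p) → Incident p m → C m
  all : ∀ {p}, ¬D p → (∀ ℓ, Incident p ℓ → C ℓ) → ∀ m, C m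

/-- The saturated transfer system classified by a triple. -/
def rel (D S C : PlaneCoord → Bool) : Flat → Flat → Prop
  | bot, bot => True
  | bot, pt p => ¬D p
  | bot, ln ℓ => S ℓ ∧ ∀ q, Incident q ℓ → ¬D q
  | bot, top => ∀ ℓ, C ℓ
  | pt p, pt q => p = q
  | pt p, ln ℓ => Incident p ℓ ∧ S ℓ ∧ ∀ q, Incident q ℓ → q ≠ p → ¬D q
  | pt p, top => ∀ ℓ, Incident p ℓ → C ℓ
  | ln ℓ, ln m => ℓ = m
  | ln ℓ, top => C ℓ
  | top, top => True
  | _, _ => False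

section

variable {D S C : PlaneCoord → Bool}

theorem Admissible.not_mem_of_pencil (h : Admissible D S C) {p q : PlaneCoord}
    (hp : ∀ ℓ, Incident p ℓ → C ℓ) (hq : q ≠ p) : ¬D q := fun hD =>
  have ⟨ℓ, hpℓ, hqℓ⟩ := exists_incident_and_not hq.symm
  hqℓ (h.incident (hp ℓ hpℓ) hD)

theorem Admissible.mem_of_pencil (h : Admissible D S C) {p : PlaneCoord}
    (hp : ∀ ℓ, Incident p ℓ → C ℓ) (ℓ : PlaneCoord) : S ℓ :=
  have ⟨m, hm, hpm⟩ := exists_incident_ne p ℓ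
  h.mem_of_ne (hp m hpm) hm.symm

theorem rel_refl (x : Flat) : rel D S C x x := by cases x <;> trivial

theorem rel_le {x y : Flat} (h : rel D S C x y) : x ≤ y := by
  cases x <;> cases y <;> simp_all [rel]

theorem rel_sat {x y z : Flat} (hxy : x ≤ y) (hyz : y ≤ z) (h : rel D S C x z) :
    rel D S C y z := by
  cases x <;> cases y <;> cases z <;> simp_all [rel, -Sum.forall]

theorem Admissible.rel_trans (h : Admissible D S C) {x y z : Flat} (hxy : rel D S C x y)
    (hyz : rel D S C y z) : rel D S C x z := by
  cases x <;> cases y <;> cases z <;> simp only [rel] at hxy hyz ⊢ <;>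
    try first | assumption | exact hxy ▸ hyz | exact hyz ▸ hxy
  · exact ⟨hyz.2.1, fun q hq => (eq_or_ne q _).elim (fun e => e ▸ hxy) (hyz.2.2 q hq)⟩
  · exact h.all hxy hyz
  · intro m
    obtain ⟨p, hp, hpm⟩ := exists_incident_both_lines _ m
    exact h.pencil hyz hxy.1 hp
      (fun q hq => (hxy.2 q (h.incident hyz hq) hq).elim) hpm
  · intro m hm
    refine h.pencil hyz hxy.2.1 hxy.1 (fun q hq => ?_) hm
    by_contra hne
    exact hxy.2.2 q (h.incident hyz hq) hne hq

theorem Admissible.rel_of_le (h : Admissible D S C) {x y z : Flat} (hxy : rel D S C x y)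
    (hxz : x ≤ z) (hzy : z ≤ y) : rel D S C x z := by
  cases x <;> cases y <;> cases z <;> try first
    | trivial
    | exact hxy
    | exact hxz.elim
    | exact hzy.elim
  · exact hzy ▸ hxy
  · exact hxy.2 _ hzy
  · exact hzy ▸ hxy
  · obtain ⟨ℓ, hℓ⟩ := exists_not_incident ‹_›
    exact fun hD => hℓ (h.incident (hxy ℓ) hD)
  · obtain ⟨p⟩ : Nonempty PlaneCoord := inferInstance
    refine ⟨h.mem_of_pencil (p := p) (fun ℓ _ => hxy ℓ) _, fun q hq hD => ?_⟩
    obtain ⟨ℓ, hℓ⟩ := exists_not_incident q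
    exact hℓ (h.incident (hxy ℓ) hD)
  · exact hzy ▸ hxy
  · exact ⟨hxz, h.mem_of_pencil hxy _, fun q _ hq => h.not_mem_of_pencil hxy hq⟩

theorem Admissible.rel_restrict (h : Admissible D S C) {x y z : Flat} (hxy : rel D S C x y)
    (hzy : z ≤ y) : rel D S C (x ⊓ z) z := by
  by_cases hxz : x ≤ z
  · rw [inf_eq_left.mpr hxz]
    exact h.rel_of_le hxy hxz hzy
  by_cases hzx : z ≤ x
  · rw [inf_eq_right.mpr hzx]
    exact rel_refl z
  cases x <;> cases z <;> try first
    | exact (hxz (bot_le _)).elim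
    | exact (hzx (bot_le _)).elim
    | exact (hxz (le_top _)).elim
    | exact (hzx (le_top _)).elim
  · rw [pt_inf_pt hxz]
    cases y
    · exact hxy.elim
    · exact (hxz (hxy.trans hzy.symm)).elim
    · exact hxy.2.2 _ hzy (Ne.symm hxz)
    · exact h.not_mem_of_pencil hxy (Ne.symm hxz)
  · rw [pt_inf_ln hxz]
    cases y
    · exact hxy.elim
    · exact hzy.elim
    · exact (hxz (hzy ▸ hxy.1)).elim
    · exact ⟨h.mem_of_pencil hxy _, fun q hq =>
        h.not_mem_of_pencil hxy fun e => hxz (e ▸ hq)⟩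
  · rw [ln_inf_pt hzx]
    cases y
    · exact hxy.elim
    · exact hxy.elim
    · exact (hzx (hxy ▸ hzy)).elim
    · exact fun hD => hzx (h.incident hxy hD)
  · rename_i ℓ m
    obtain ⟨p, hpℓ, hpm⟩ := exists_incident_both_lines ℓ m
    rw [ln_inf_ln hxz hpℓ hpm]
    cases y
    · exact hxy.elim
    · exact hxy.elim
    · exact (hxz (hxy.trans hzy.symm)).elim
    · exact ⟨hpm, h.mem_of_ne hxy (Ne.symm hxz), fun q hq hqp hD =>
        hqp (eq_of_incident hxz (h.incident hxy hD) hq hpℓ hpm)⟩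

theorem Admissible.isSat (h : Admissible D S C) : IsSat (rel D S C) :=
  ⟨rel_refl, h.rel_trans, rel_le, h.rel_restrict, rel_sat⟩

theorem Admissible.mem_iff (h : Admissible D S C) (ℓ : PlaneCoord) :
    S ℓ ↔ ∃ p, rel D S C (pt p) (ln ℓ) := by
  refine ⟨fun hS => ?_, fun ⟨p, hp⟩ => hp.2.1⟩
  by_cases hD : ∃ p, Incident p ℓ ∧ D p
  · obtain ⟨p, hp, hpD⟩ := hD
    exact ⟨p, hp, hS, fun q hq hqp hqD => hqp (h.eq_of_mem hS hq hp hqD hpD)⟩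
  · obtain ⟨p, hp⟩ := exists_incident ℓ
    exact ⟨p, hp, hS, fun q hq _ hqD => hD ⟨q, hq, hqD⟩⟩

end

namespace IsSat

variable {T : Flat → Flat → Prop} {p q ℓ m : PlaneCoord}

theorem bot_pt_of_pt_ln (h : IsSat T) (hT : T (pt p) (ln ℓ)) (hq : Incident q ℓ)
    (hqp : q ≠ p) : T bot (pt q) :=
  pt_inf_pt hqp.symm ▸ h.restrict hT hq

theorem bot_pt_of_bot_ln (h : IsSat T) (hT : T bot (ln ℓ)) (hp : Incident p ℓ) : T bot (pt p) :=
  h.restrict hT hp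

theorem pt_ln_of_pt_ln (h : IsSat T) (hT : T (pt q) (ln ℓ)) (hp : Incident p ℓ)
    (hD : ∀ r, Incident r ℓ → r ≠ p → T bot (pt r)) : T (pt p) (ln ℓ) := by
  obtain rfl | hqp := eq_or_ne q p
  · exact hT
  · exact h.sat (bot_le _) hp (h.trans (hD q (h.le hT) hqp) hT)

theorem bot_pt_of_ln_top (h : IsSat T) (hT : T (ln ℓ) top) (hp : ¬Incident p ℓ) : T bot (pt p) :=
  ln_inf_pt hp ▸ h.restrict hT (le_top _)

theorem pt_ln_of_ln_top (h : IsSat T) (hT : T (ln ℓ) top) (hne : ℓ ≠ m) (hℓ : Incident p ℓ)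
    (hm : Incident p m) : T (pt p) (ln m) :=
  ln_inf_ln hne hℓ hm ▸ h.restrict hT (le_top _)

theorem pt_top_of_pencil (h : IsSat T) (hT : ∀ ℓ, Incident p ℓ → T (ln ℓ) top) :
    T (pt p) top := by
  obtain ⟨ℓ, hℓ, -⟩ := exists_incident_both_points p p
  obtain ⟨m, hne, hm⟩ := exists_incident_ne p ℓ
  exact h.trans (h.pt_ln_of_ln_top (hT m hm) hne hm hℓ) (hT ℓ hℓ)

/-- The points not related to the bottom. -/
noncomputable def points (T : Flat → Flat → Prop) (p : PlaneCoord) : Bool :=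
  open Classical in decide ¬T bot (pt p)

/-- The lines related to some point. -/
noncomputable def lines (T : Flat → Flat → Prop) (ℓ : PlaneCoord) : Bool :=
  open Classical in decide (∃ p, T (pt p) (ln ℓ))

/-- The lines related to the top. -/
noncomputable def colines (T : Flat → Flat → Prop) (ℓ : PlaneCoord) : Bool :=
  open Classical in decide (T (ln ℓ) top)

theorem points_iff : points T p ↔ ¬T bot (pt p) := by simp [points]

theorem not_points_iff : ¬points T p ↔ T bot (pt p) := by rw [points_iff, not_not]

theorem lines_iff : lines T ℓ ↔ ∃ p, T (pt p) (ln ℓ) := by simp [lines, -Sum.exists]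

theorem colines_iff : colines T ℓ ↔ T (ln ℓ) top := by simp [colines]

theorem admissible (h : IsSat T) : Admissible (points T) (lines T) (colines T) where
  eq_of_mem {ℓ p q} hS hp hq hDp hDq := by
    obtain ⟨r, hr⟩ := lines_iff.mp hS
    have key {s} (hs : Incident s ℓ) (hD : points T s) : s = r := by
      by_contra hne
      exact points_iff.mp hD (h.bot_pt_of_pt_ln hr hs hne)
    exact (key hp hDp).trans (key hq hDq).symm
  incident {ℓ p} hC hD := by
    by_contra hp
    exact points_iff.mp hD (h.bot_pt_of_ln_top (colines_iff.mp hC) hp)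
  mem_of_ne {ℓ m} hC hne := by
    obtain ⟨p, hp, hpm⟩ := exists_incident_both_lines ℓ m
    exact lines_iff.mpr ⟨p, h.pt_ln_of_ln_top (colines_iff.mp hC) hne.symm hp hpm⟩
  pencil {ℓ m p} hC hS hp hD hm := by
    obtain ⟨r, hr⟩ := lines_iff.mp hS
    have hT : T (pt p) (ln ℓ) := h.pt_ln_of_pt_ln hr hp fun q _ hqp =>
      not_points_iff.mp fun hq => hqp (hD q hq)
    exact colines_iff.mpr (h.sat hm (le_top _) (h.trans hT (colines_iff.mp hC)))
  all {p} hD hC m := colines_iff.mpr (h.sat (bot_le _) (le_top _) (h.trans (not_points_iff.mp hD)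
    (h.pt_top_of_pencil fun ℓ hℓ => colines_iff.mp (hC ℓ hℓ))))

theorem rel_iff (h : IsSat T) (x y : Flat) :
    rel (points T) (lines T) (colines T) x y ↔ T x y := by
  have hrefl := h.refl
  have hle {x y} (hxy : ¬x ≤ y) : False ↔ T x y := ⟨False.elim, fun hT => hxy (h.le hT)⟩
  cases x <;> cases y <;> simp only [rel, not_points_iff, lines_iff, colines_iff] <;> try first
    | exact iff_of_true trivial (hrefl _)
    | exact ⟨fun e => e ▸ hrefl _, fun hT => h.le hT⟩
    | exact hle id
  · refine ⟨fun ⟨⟨p, hp⟩, hD⟩ => h.trans (hD p (h.le hp)) hp, fun hT => ⟨?_, fun q hq =>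
      h.bot_pt_of_bot_ln hT hq⟩⟩
    obtain ⟨p, hp⟩ := exists_incident _
    exact ⟨p, h.sat (bot_le _) hp hT⟩
  · refine ⟨fun hC => ?_, fun hT ℓ => h.sat (bot_le _) (le_top _) hT⟩
    obtain ⟨p⟩ : Nonempty PlaneCoord := inferInstance
    obtain ⟨ℓ, hℓ⟩ := exists_not_incident p
    exact h.trans (h.bot_pt_of_ln_top (hC ℓ) hℓ) (h.pt_top_of_pencil fun ℓ _ => hC ℓ)
  · exact ⟨fun ⟨hp, ⟨q, hq⟩, hD⟩ => h.pt_ln_of_pt_ln hq hp hD,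
      fun hT => ⟨h.le hT, ⟨_, hT⟩, fun q hq hqp => h.bot_pt_of_pt_ln hT hq hqp⟩⟩
  · exact ⟨h.pt_top_of_pencil, fun hT ℓ hℓ => h.sat hℓ (le_top _) hT⟩

end IsSat

/-- Saturated transfer systems on the flats are classified by admissible triples. -/
noncomputable def isSatEquiv : {T : Flat → Flat → Prop // IsSat T} ≃
    {t : (PlaneCoord → Bool) × (PlaneCoord → Bool) × (PlaneCoord → Bool) //
      Admissible t.1 t.2.1 t.2.2} where
  toFun T := ⟨(IsSat.points T.1, IsSat.lines T.1, IsSat.colines T.1), T.2.admissible⟩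
  invFun t := ⟨rel t.1.1 t.1.2.1 t.1.2.2, t.2.isSat⟩
  left_inv T := Subtype.ext (funext₂ fun x y => propext (T.2.rel_iff x y))
  right_inv := by
    rintro ⟨⟨D, S, C⟩, ht⟩
    refine Subtype.ext (Prod.ext ?_ (Prod.ext ?_ ?_)) <;> funext ℓ <;> rw [Bool.eq_iff_iff]
    · rw [IsSat.points_iff]
      exact not_not
    · rw [IsSat.lines_iff]
      exact (ht.mem_iff ℓ).symm
    · rw [IsSat.colines_iff]
      exact Iff.rfl

end Flat

/-! ### Counting admissible triples -/

theorem pointCount_le_one_iff (D : PlaneCoord → Bool) (ℓ : PlaneCoord) : pointCount D ℓ ≤ 1 ↔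
    ∀ p q, Incident p ℓ → Incident q ℓ → D p → D q → p = q := by
  have h : pointCount D ℓ = (univ.filter fun p => Incident p ℓ ∧ D p).card := by
    rw [card_filter, pointCount]
    exact sum_congr rfl fun p _ => by cases D p <;> simp
  rw [h, card_le_one]
  simp only [mem_filter_univ]
  exact ⟨fun H p q hp hq hDp hDq => H p ⟨hp, hDp⟩ q ⟨hq, hDq⟩,
    fun H p hp q hq => H p q hp.1 hq.1 hp.2 hq.2⟩

theorem card_bool_imp (P : Prop) [Decidable P] :
    Nat.card {b : Bool // b → P} = if P then 2 else 1 := by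
  split_ifs with h <;> simp [h]

theorem card_forall_imp (P : PlaneCoord → Prop) [DecidablePred P] :
    Nat.card {D : PlaneCoord → Bool // ∀ p, D p → P p} = ∏ p, if P p then 2 else 1 := by
  rw [Nat.card_congr (Equiv.subtypePiEquivPi (p := fun p (b : Bool) => b → P p)), Nat.card_pi]
  exact prod_congr rfl fun p _ => card_bool_imp (P p)

/-- The disjoint union of the four kinds of admissible triples, with respectively no, one, six and
all lines related to the top. -/
abbrev TripleKinds : Type :=
  (Σ D : PlaneCoord → Bool, {S : PlaneCoord → Bool // ∀ ℓ, S ℓ → pointCount D ℓ ≤ 1}) ⊕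
    (Σ ℓ : PlaneCoord, {D : PlaneCoord → Bool // ∀ p, D p → Incident p ℓ}) ⊕ PlaneCoord ⊕ Unit

theorem card_tripleKinds : Nat.card TripleKinds = 13784538270571 := by
  have h₁ (D : PlaneCoord → Bool) : Nat.card {S : PlaneCoord → Bool // ∀ ℓ, S ℓ →
      pointCount D ℓ ≤ 1} = ∏ ℓ, lineWeight (pointCount D ℓ) := by
    rw [card_forall_imp]
    exact prod_congr rfl fun ℓ _ => by rw [lineWeight_eq]; split_ifs <;> rfl
  have h₂ : ∑ ℓ, ∏ p, (if Incident p ℓ then 2 else 1) = 31 * 64 := by decide +kernel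
  simp only [Nat.card_sum, Nat.card_sigma, h₁, card_forall_imp, sum_prod_lineWeight, h₂]
  simp

namespace Flat

/-- The triple of a given kind. -/
def ofKind : TripleKinds → (PlaneCoord → Bool) × (PlaneCoord → Bool) × (PlaneCoord → Bool)
  | .inl ⟨D, S⟩ => (D, S.1, fun _ => false)
  | .inr (.inl ⟨ℓ, D⟩) => (D.1, fun m => decide (m ≠ ℓ), fun m => decide (m = ℓ))
  | .inr (.inr (.inl p)) => (fun q => decide (q = p), fun _ => true, fun ℓ => decide (Incident p ℓ))
  | .inr (.inr (.inr _)) => (fun _ => false, fun _ => true, fun _ => true)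

theorem admissible_ofKind (t : TripleKinds) :
    Admissible (ofKind t).1 (ofKind t).2.1 (ofKind t).2.2 := by
  obtain ⟨D, S, hS⟩ | ⟨ℓ, D, hD⟩ | p | _ := t <;> simp only [ofKind]
  · refine ⟨fun {ℓ p q} h hp hq => (pointCount_le_one_iff D ℓ).mp (hS ℓ h) p q hp hq, ?_, ?_, ?_,
      fun {p} _ h => ?_⟩
    · simp
    · simp
    · simp
    · obtain ⟨ℓ, hℓ, -⟩ := exists_incident_both_points p p
      exact absurd (h ℓ hℓ) (by simp)
  · refine ⟨fun {m p q} h hp hq hDp hDq => ?_, fun {m p} h hDp => ?_, fun {m k} h hne => ?_,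
      fun {m k p} h hS => ?_, fun {p} _ h => ?_⟩
    · exact eq_of_incident (of_decide_eq_true h) hp (hD p hDp) hq (hD q hDq)
    · exact of_decide_eq_true h ▸ hD p hDp
    · exact decide_eq_true (of_decide_eq_true h ▸ hne)
    · exact (of_decide_eq_true hS (of_decide_eq_true h)).elim
    · obtain ⟨m, hne, hm⟩ := exists_incident_ne p ℓ
      exact (hne (of_decide_eq_true (h m hm))).elim
  · refine ⟨fun {m r q} _ _ _ hr hq => ?_, fun {m q} h hq => ?_, fun _ _ => rfl,
      fun {m k q} h _ hq hD hk => ?_, fun {q} hq h => ?_⟩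
    · exact (of_decide_eq_true hr).trans (of_decide_eq_true hq).symm
    · exact of_decide_eq_true hq ▸ of_decide_eq_true h
    · exact decide_eq_true (hD p (decide_eq_true rfl) ▸ hk)
    · obtain ⟨m, hqm, hpm⟩ := exists_incident_and_not fun e => hq (decide_eq_true e)
      exact (hpm (of_decide_eq_true (h m hqm))).elim
  · exact ⟨fun _ _ _ h => absurd h (by simp), fun _ h => absurd h (by simp), fun _ _ => rfl,
      fun _ _ _ _ _ => rfl, fun _ _ _ => rfl⟩

theorem ofKind_injective : Function.Injective ofKind := by
  have hpt {p q : PlaneCoord} (h : ∀ r, decide (r = p) = decide (r = q)) : p = q := by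
    simpa using h p
  have hpencil (p ℓ : PlaneCoord) (h : ∀ m, decide (m = ℓ) = decide (Incident p m)) : False := by
    obtain ⟨m, hm, hpm⟩ := exists_incident_ne p ℓ
    exact hm ((decide_eq_decide.mp (h m)).mpr hpm)
  have hempty (p : PlaneCoord) (h : ∀ m, false = decide (Incident p m)) : False := by
    obtain ⟨m, hm, -⟩ := exists_incident_both_points p p
    exact of_decide_eq_false (h m).symm hm
  have hall (p : PlaneCoord) (h : ∀ m, decide (Incident p m) = true) : False := by
    obtain ⟨m, hm⟩ := exists_not_incident p
    exact hm (of_decide_eq_true (h m))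
  have hline (ℓ : PlaneCoord) (h : ∀ m, decide (m = ℓ) = true) : False := by
    obtain ⟨p, -⟩ := exists_incident ℓ
    obtain ⟨m, hm, -⟩ := exists_incident_ne p ℓ
    exact hm (of_decide_eq_true (h m))
  rintro (⟨D, S, hS⟩ | ⟨ℓ, D, hD⟩ | p | _) (⟨D', S', hS'⟩ | ⟨ℓ', D', hD'⟩ | p' | _) h <;>
    obtain ⟨hD, hS, hC⟩ := Prod.ext_iff.trans (and_congr_right' Prod.ext_iff) |>.mp h <;>
    replace hC := congrFun hC <;> simp only [ofKind] at hD hS hC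
  · subst hD hS; rfl
  · exact absurd (hC ℓ') (by simp)
  · exact (hempty _ hC).elim
  · exact absurd (hC (.inr (.inr ()))) (by simp)
  · exact absurd (hC ℓ) (by simp)
  · obtain rfl := hpt hC
    subst hD
    rfl
  · exact (hpencil _ _ hC).elim
  · exact (hline _ hC).elim
  · exact (hempty _ fun m => (hC m).symm).elim
  · exact (hpencil _ _ fun m => (hC m).symm).elim
  · rw [hpt (congrFun hD)]
  · exact (hall _ hC).elim
  · exact absurd (hC (.inr (.inr ()))) (by simp)
  · exact (hline _ fun m => (hC m).symm).elim
  · exact (hall _ fun m => (hC m).symm).elim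
  · rfl

theorem exists_ofKind {D S C : PlaneCoord → Bool} (h : Admissible D S C) :
    ∃ t, ofKind t = (D, S, C) := by
  by_cases hC : ∃ ℓ, C ℓ
  swap
  · refine ⟨.inl ⟨D, S, fun ℓ hℓ => (pointCount_le_one_iff D ℓ).mpr fun p q => h.eq_of_mem hℓ⟩, ?_⟩
    refine Prod.ext rfl (Prod.ext rfl (funext fun ℓ => ?_))
    exact (Bool.eq_false_of_not_eq_true fun hℓ => hC ⟨ℓ, hℓ⟩).symm
  obtain ⟨ℓ, hℓ⟩ := hC
  by_cases hall : ∀ m, C m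
  · refine ⟨.inr (.inr (.inr ())), Prod.ext (funext fun p => ?_) (Prod.ext (funext fun m => ?_)
      (funext fun m => (hall m).symm))⟩
    · obtain ⟨m, hm⟩ := exists_not_incident p
      exact (Bool.eq_false_of_not_eq_true fun hD => hm (h.incident (hall m) hD)).symm
    · obtain ⟨p, -⟩ := exists_incident m
      exact (h.mem_of_pencil (p := p) (fun k _ => hall k) m).symm
  by_cases hone : ∀ m, C m → m = ℓ
  · have hS : ¬S ℓ := fun hS => by
      obtain ⟨p, hp, hD⟩ : ∃ p, Incident p ℓ ∧ ∀ q, D q → q = p := by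
        by_cases hD : ∃ p, D p
        · obtain ⟨p, hp⟩ := hD
          exact ⟨p, h.incident hℓ hp, fun q hq =>
            h.eq_of_mem hS (h.incident hℓ hq) (h.incident hℓ hp) hq hp⟩
        · obtain ⟨p, hp⟩ := exists_incident ℓ
          exact ⟨p, hp, fun q hq => (hD ⟨q, hq⟩).elim⟩
      obtain ⟨m, hne, hm⟩ := exists_incident_ne p ℓ
      exact hne (hone m (h.pencil hℓ hS hp hD hm))
    refine ⟨.inr (.inl ⟨ℓ, D, fun p => h.incident hℓ⟩), Prod.ext rfl (Prod.ext (funext fun m => ?_)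
      (funext fun m => ?_))⟩ <;> rw [Bool.eq_iff_iff] <;> refine decide_eq_true_iff.trans ?_
    · exact ⟨h.mem_of_ne hℓ, fun hm e => hS (e ▸ hm)⟩
    · exact ⟨fun e => e ▸ hℓ, hone m⟩
  obtain ⟨k, hk, hkℓ⟩ : ∃ k, C k ∧ k ≠ ℓ := by simpa [-Sum.forall, -Sum.exists] using hone
  have hS (m : PlaneCoord) : S m := by
    obtain rfl | hm := eq_or_ne m ℓ
    · exact h.mem_of_ne hk hkℓ.symm
    · exact h.mem_of_ne hℓ hm
  obtain ⟨p, hpℓ, hpk⟩ := exists_incident_both_lines ℓ k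
  have hD (q : PlaneCoord) (hq : D q) : q = p :=
    eq_of_incident hkℓ.symm (h.incident hℓ hq) (h.incident hk hq) hpℓ hpk
  have hpC {m : PlaneCoord} (hm : Incident p m) : C m := h.pencil hℓ (hS ℓ) hpℓ hD hm
  have hp : D p := by
    by_contra hp
    exact hall (h.all hp fun m => hpC)
  refine ⟨.inr (.inr (.inl p)), Prod.ext (funext fun q => ?_) (Prod.ext
    (funext fun m => (hS m).symm) (funext fun m => ?_))⟩ <;> rw [Bool.eq_iff_iff] <;>
    refine decide_eq_true_iff.trans ?_
  · exact ⟨fun e => e ▸ hp, hD q⟩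
  · exact ⟨hpC, fun hm => h.incident hm hp⟩

theorem card_isSat : Nat.card {T : Flat → Flat → Prop // IsSat T} = 13784538270571 := by
  rw [Nat.card_congr isSatEquiv, ← card_tripleKinds]
  refine (Nat.card_congr (Equiv.ofBijective (fun t => ⟨ofKind t, admissible_ofKind t⟩) ⟨?_, ?_⟩)).symm
  · exact fun s t h => ofKind_injective (congrArg Subtype.val h)
  · rintro ⟨⟨D, S, C⟩, h⟩
    exact (exists_ofKind h).imp fun t ht => Subtype.ext ht

end Flat

/-! ### The subgroup lattice as the lattice of flats -/

/-- Homogeneous coordinates of a point. -/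
def pointVec : PlaneCoord → Fin 3 → ZMod 5
  | .inl (x, y) => ![x, y, 1]
  | .inr (.inl n) => ![n, 1, 0]
  | .inr (.inr _) => ![1, 0, 0]

/-- Homogeneous coordinates of a line. -/
def lineVec : PlaneCoord → Fin 3 → ZMod 5
  | .inl (m, c) => ![1, -m, -c]
  | .inr (.inl c) => ![0, 1, -c]
  | .inr (.inr _) => ![0, 0, 1]

theorem incident_iff (p ℓ : PlaneCoord) : Incident p ℓ ↔ lineVec ℓ ⬝ᵥ pointVec p = 0 := by
  revert p ℓ; decide +kernel

theorem exists_eq_smul_pointVec {v : Fin 3 → ZMod 5} (hv : v ≠ 0) :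
    ∃ p, ∃ k k' : ZMod 5, v = k • pointVec p ∧ pointVec p = k' • v := by
  have h : ∀ k : ZMod 5, k ≠ 0 → ∃ k' : ZMod 5, k' * k = 1 := by decide
  have key {p : PlaneCoord} {k : ZMod 5} (hk : v = k • pointVec p) :
      ∃ p, ∃ k k' : ZMod 5, v = k • pointVec p ∧ pointVec p = k' • v := by
    obtain ⟨k', hk'⟩ := h k fun h0 => hv (by rw [hk, h0, zero_smul])
    exact ⟨p, k, k', hk, by rw [hk, smul_smul, hk', one_smul]⟩
  by_cases h₂ : v 2 = 0
  · by_cases h₁ : v 1 = 0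
    · refine key (p := .inr (.inr ())) (k := v 0) (funext fun i => ?_)
      fin_cases i <;> simp [pointVec, h₁, h₂]
    · obtain ⟨k', hk'⟩ := h _ h₁
      refine key (p := .inr (.inl (k' * v 0))) (k := v 1) (funext fun i => ?_)
      fin_cases i <;> simp [pointVec, h₂]
      linear_combination -v 0 * hk'
  · obtain ⟨k', hk'⟩ := h _ h₂
    refine key (p := .inl (k' * v 0, k' * v 1)) (k := v 2) (funext fun i => ?_)
    fin_cases i <;> simp [pointVec]
    · linear_combination -v 0 * hk'
    · linear_combination -v 1 * hk'

theorem pointVec_ne_zero (p : PlaneCoord) : pointVec p ≠ 0 := by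
  revert p; decide +kernel

theorem exists_incident_line_and_not {ℓ m : PlaneCoord} (h : ℓ ≠ m) :
    ∃ p, Incident p ℓ ∧ ¬Incident p m := by
  revert ℓ m; decide +kernel

theorem exists_point_incident_ne (ℓ p : PlaneCoord) : ∃ q, q ≠ p ∧ Incident q ℓ := by
  revert ℓ p; decide +kernel

theorem exists_point_not_incident (ℓ : PlaneCoord) : ∃ p, ¬Incident p ℓ := by
  revert ℓ; decide +kernel

theorem exists_eq_mul {u v : ZMod 5} (hv : v ≠ 0) : ∃ b, u = b * v := by
  revert u v; decide +kernel

namespace Flat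

/-- The subgroup corresponding to a flat. -/
def toAddSubgroup : Flat → AddSubgroup (Fin 3 → ZMod 5)
  | bot => ⊥
  | pt p => AddSubgroup.zmultiples (pointVec p)
  | ln ℓ => ((dotProductBilin (ZMod 5) (ZMod 5) (lineVec ℓ)).toAddMonoidHom).ker
  | top => ⊤

theorem mem_pt {v : Fin 3 → ZMod 5} {p : PlaneCoord} :
    v ∈ (pt p).toAddSubgroup ↔ ∃ k : ZMod 5, k • pointVec p = v := by
  refine ⟨fun ⟨n, hn⟩ => ⟨n, ?_⟩, fun ⟨k, hk⟩ => hk ▸ ZMod.smul_mem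
    (AddSubgroup.mem_zmultiples _) k⟩
  rw [Int.cast_smul_eq_zsmul]
  exact hn

theorem pointVec_mem {p : PlaneCoord} {x : Flat} : pointVec p ∈ x.toAddSubgroup ↔ pt p ≤ x := by
  cases x with
  | bot => exact iff_of_false (pointVec_ne_zero p) not_pt_le_bot
  | pt q =>
    refine mem_pt.trans ⟨fun ⟨k, hk⟩ => ?_, fun e => ⟨1, by rw [e, one_smul]⟩⟩
    by_contra hne
    obtain ⟨ℓ, hq, hp⟩ := exists_incident_and_not (Ne.symm hne)
    rw [incident_iff] at hq hp
    exact hp (by rw [← hk, dotProduct_smul, hq, smul_zero])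
  | ln ℓ => exact (incident_iff p ℓ).symm
  | top => exact iff_of_true trivial trivial

theorem le_of_pt_le {x y : Flat} (h : ∀ p, pt p ≤ x → pt p ≤ y) : x ≤ y := by
  obtain ⟨p₀⟩ : Nonempty PlaneCoord := inferInstance
  cases x with
  | bot => exact bot_le y
  | pt p => exact h p le_rfl
  | ln ℓ =>
    cases y with
    | bot => exact (exists_incident ℓ).elim fun p hp => h p hp
    | pt q =>
      obtain ⟨p, hne, hp⟩ := exists_point_incident_ne ℓ q
      exact hne (h p hp)
    | ln m =>
      by_contra hne
      obtain ⟨p, hp, hp'⟩ := exists_incident_line_and_not hne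
      exact hp' (h p hp)
    | top => exact le_top _
  | top =>
    cases y with
    | bot => exact h p₀ trivial
    | pt q =>
      obtain ⟨ℓ, -⟩ := exists_not_incident q
      obtain ⟨p, hne, -⟩ := exists_point_incident_ne ℓ q
      exact hne (h p trivial)
    | ln m => exact (exists_point_not_incident m).elim fun p hp => hp (h p trivial)
    | top => exact le_top _

theorem addSubgroup_le {H K : AddSubgroup (Fin 3 → ZMod 5)}
    (h : ∀ p, pointVec p ∈ H → pointVec p ∈ K) : H ≤ K := fun v hv => by
  obtain rfl | hne := eq_or_ne v 0
  · exact K.zero_mem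
  · obtain ⟨p, k, k', hk, hk'⟩ := exists_eq_smul_pointVec hne
    exact hk ▸ ZMod.smul_mem (h p (hk' ▸ ZMod.smul_mem hv k')) k

theorem toAddSubgroup_le_iff {x y : Flat} : x.toAddSubgroup ≤ y.toAddSubgroup ↔ x ≤ y :=
  ⟨fun h => le_of_pt_le fun _ hp => pointVec_mem.mp (h (pointVec_mem.mpr hp)),
    fun h => addSubgroup_le fun _ hp => pointVec_mem.mpr ((pointVec_mem.mp hp).trans h)⟩

theorem pointVec_mem_of_incident {H : AddSubgroup (Fin 3 → ZMod 5)} {p q r ℓ : PlaneCoord}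
    (hne : p ≠ q) (hp : pointVec p ∈ H) (hq : pointVec q ∈ H) (hpℓ : Incident p ℓ)
    (hqℓ : Incident q ℓ) (hrℓ : Incident r ℓ) : pointVec r ∈ H := by
  obtain ⟨m, hpm, hqm⟩ := exists_incident_and_not hne
  obtain ⟨b, hb⟩ := exists_eq_mul (u := lineVec m ⬝ᵥ pointVec r) ((incident_iff q m).not.mp hqm)
  have hbH : b • pointVec q ∈ H := ZMod.smul_mem hq b
  rw [← sub_add_cancel (pointVec r) (b • pointVec q)]
  refine H.add_mem ?_ hbH
  obtain h0 | hv := eq_or_ne (pointVec r - b • pointVec q) 0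
  · exact h0 ▸ H.zero_mem
  obtain ⟨s, k, k', hk, hk'⟩ := exists_eq_smul_pointVec hv
  have hsm : Incident s m := by
    rw [incident_iff, hk', dotProduct_smul, dotProduct_sub, dotProduct_smul, hb,
      ← smul_eq_mul b, sub_self, smul_zero]
  have hsℓ : Incident s ℓ := by
    rw [incident_iff] at hrℓ hqℓ ⊢
    rw [hk', dotProduct_smul, dotProduct_sub, dotProduct_smul, hrℓ, hqℓ, smul_zero, sub_zero,
      smul_zero]
  have hℓm : ℓ ≠ m := fun e => hqm (e ▸ hqℓ)
  rw [hk, eq_of_incident hℓm hsℓ hsm hpℓ hpm]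
  exact ZMod.smul_mem hp k

theorem toAddSubgroup_surjective : Function.Surjective toAddSubgroup := fun H => by
  have hH {x : Flat} (h : ∀ p, pt p ≤ x ↔ pointVec p ∈ H) : ∃ y, toAddSubgroup y = H :=
    ⟨x, le_antisymm (addSubgroup_le fun p hp => (h p).mp (pointVec_mem.mp hp))
      (addSubgroup_le fun p hp => pointVec_mem.mpr ((h p).mpr hp))⟩
  by_cases h₁ : ∃ p, pointVec p ∈ H
  swap
  · exact hH (x := bot) fun p => iff_of_false not_pt_le_bot fun hp => h₁ ⟨p, hp⟩
  obtain ⟨p, hp⟩ := h₁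
  by_cases h₂ : ∃ q, pointVec q ∈ H ∧ q ≠ p
  swap
  · exact hH (x := pt p) fun q => ⟨fun e => (pt_le_pt.mp e) ▸ hp, fun hq => by
      by_contra hne
      exact h₂ ⟨q, hq, hne⟩⟩
  obtain ⟨q, hq, hqp⟩ := h₂
  obtain ⟨ℓ, hpℓ, hqℓ⟩ := exists_incident_both_points p q
  have hℓ {r : PlaneCoord} (hr : Incident r ℓ) : pointVec r ∈ H :=
    pointVec_mem_of_incident hqp.symm hp hq hpℓ hqℓ hr
  by_cases h₃ : ∃ r, pointVec r ∈ H ∧ ¬Incident r ℓ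
  swap
  · exact hH (x := ln ℓ) fun r => ⟨hℓ, fun hr => by
      by_contra hne
      exact h₃ ⟨r, hr, hne⟩⟩
  obtain ⟨r, hr, hrℓ⟩ := h₃
  refine hH (x := top) fun s => iff_of_true trivial ?_
  obtain ⟨m, hrm, hsm⟩ := exists_incident_both_points r s
  obtain ⟨t, htℓ, htm⟩ := exists_incident_both_lines ℓ m
  exact pointVec_mem_of_incident (fun e : t = r => hrℓ (e ▸ htℓ)) (hℓ htℓ) hr htm hrm hsm

/-- The lattice of flats is the lattice of subgroups. -/
noncomputable def orderIso : Flat ≃o AddSubgroup (Fin 3 → ZMod 5) :=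
  RelIso.ofSurjective (⟨⟨toAddSubgroup, fun _ _ h => le_antisymm (toAddSubgroup_le_iff.mp h.le)
    (toAddSubgroup_le_iff.mp h.ge)⟩, toAddSubgroup_le_iff⟩ : Flat ↪o _) toAddSubgroup_surjective

/-- Saturated transfer systems on the subgroup lattice, as relations between flats. -/
noncomputable def isSaturatedTSEquiv :
    {T : Set (AddSubgroup (Fin 3 → ZMod 5) × AddSubgroup (Fin 3 → ZMod 5)) // IsSaturatedTS T} ≃
      {T : Flat → Flat → Prop // IsSat T} where
  toFun T := ⟨fun x y => (orderIso x, orderIso y) ∈ T.1,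
    ⟨fun _ => T.2.1.1 _, T.2.1.2.1 _ _ _, fun h => orderIso.le_iff_le.mp (T.2.1.2.2.1 _ _ h),
      fun {x y z} h hz => orderIso.map_inf x z ▸
        T.2.1.2.2.2 _ _ _ h (orderIso.monotone hz),
      fun hxy hyz => T.2.2 _ _ _ (orderIso.monotone hxy) (orderIso.monotone hyz)⟩⟩
  invFun T := ⟨{a | T.1 (orderIso.symm a.1) (orderIso.symm a.2)},
    ⟨fun _ => T.2.refl _, fun _ _ _ => T.2.trans, fun _ _ h => orderIso.symm.le_iff_le.mp (T.2.le h),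
      fun x y z h hz => by
        simpa only [Set.mem_ofPred_eq, orderIso.symm.map_inf] using
          T.2.restrict h (orderIso.symm.monotone hz)⟩,
    fun _ _ _ hxy hyz => T.2.sat (orderIso.symm.monotone hxy) (orderIso.symm.monotone hyz)⟩
  left_inv T := by simp
  right_inv T := by simp

end Flat

/-- Theorem B: there are exactly 13,784,538,270,571 saturated transfer systems on the subgroup
lattice of the elementary abelian group `C_5^3`. -/
theorem card_sat_C5_3 :
    Nat.card {T : Set (AddSubgroup (Fin 3 → ZMod 5) × AddSubgroup (Fin 3 → ZMod 5)) //
      IsSaturatedTS T} = 13784538270571 := by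
  rw [Nat.card_congr Flat.isSaturatedTSEquiv, Flat.card_isSat]
end

section
/- Let L be a finite lattice and let T be a transfer system on L. Define T^♮ = {(b, c) : b ≤ c and there exists a ≤ b with (a, c) ∈ T}. Then T^♮ is the smallest saturated transfer system on L containing T. -/
/-- `T^♮ = {(b,c) : b ≤ c ∧ ∃ a ≤ b, (a,c) ∈ T}` is the smallest saturated transfer system
containing the transfer system `T`. -/
theorem natural_eq_satGen (L : Type*) [Lattice L] [Finite L] (T Tn : Set (L × L))
    (hT : IsTransferSystem T)
    (hTn : Tn = {p : L × L | p.1 ≤ p.2 ∧ ∃ a : L, a ≤ p.1 ∧ (a, p.2) ∈ T}) :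
    IsSaturatedTS Tn ∧ T ⊆ Tn ∧
      ∀ S : Set (L × L), IsSaturatedTS S → T ⊆ S → Tn ⊆ S := by
  subst hTn
  obtain ⟨hrefl, htrans, hle, hres⟩ := hT
  refine ⟨⟨⟨?_, ?_, ?_, ?_⟩, ?_⟩, ?_, ?_⟩
  · exact fun x => ⟨le_rfl, x, le_rfl, hrefl x⟩
  · rintro x y z ⟨hxy, a, hax, hay⟩ ⟨hyz, b, hby, hbz⟩
    exact ⟨hxy.trans hyz, a ⊓ b, inf_le_left.trans hax, htrans _ _ _ (hres _ _ _ hay hby) hbz⟩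
  · exact fun _ _ h => h.1
  · rintro x y z ⟨_, a, hax, hay⟩ hzy
    exact ⟨inf_le_right, a ⊓ z, inf_le_inf_right z hax, hres _ _ _ hay hzy⟩
  · rintro x y z hxy hyz ⟨_, a, hax, haz⟩
    exact ⟨hyz, a, hax.trans hxy, haz⟩
  · rintro ⟨x, y⟩ h
    exact ⟨hle _ _ h, x, le_rfl, h⟩
  · rintro S hS hTS ⟨b, c⟩ ⟨hbc, a, hab, hac⟩
    exact hS.2 _ _ _ hab hbc (hTS hac)
end

section
/- Let L be a modular lattice and let x ⋖ y be a covering relation in L. Then every pair (a, b) in the transfer system ⌊x → y⌋ is either an identity relation (a = b) or a covering relation (a ⋖ b). -/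
/-- The restrictions of `(x, y)`, together with the identity relations, form a transfer system. -/
theorem isTransferSystem_restrictions {L : Type*} [Lattice L] (x y : L) :
    IsTransferSystem {p : L × L | p.1 = p.2 ∨ p.2 ≤ y ∧ p.1 = x ⊓ p.2} := by
  refine ⟨fun a => Or.inl rfl, ?_, ?_, ?_⟩ <;> simp only [Set.mem_ofPred_eq]
  · rintro a b c (rfl | ⟨hb, rfl⟩) (rfl | ⟨hc, rfl⟩)
    · exact Or.inl rfl
    · exact Or.inr ⟨hc, rfl⟩
    · exact Or.inr ⟨hb, rfl⟩
    · exact Or.inr ⟨hc, by simp⟩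
  · rintro a b (rfl | ⟨-, rfl⟩)
    · exact le_rfl
    · exact inf_le_right
  · rintro a b z (rfl | ⟨hb, rfl⟩) hz
    · exact Or.inl (inf_eq_right.2 hz)
    · exact Or.inr ⟨hz.trans hb, by simp only [inf_assoc, inf_eq_right.2 hz]⟩

/-- In a modular lattice, restricting a covering relation yields an identity or a covering
relation. -/
theorem CovBy.inf_eq_or_inf_covBy {L : Type*} [Lattice L] [IsModularLattice L] {x y z : L}
    (h : x ⋖ y) (hz : z ≤ y) : x ⊓ z = z ∨ x ⊓ z ⋖ z := by
  rcases h.eq_or_eq le_sup_left (sup_le h.le hz) with hx | hy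
  · exact Or.inl (inf_eq_right.2 (sup_eq_left.1 hx))
  · exact Or.inr (inf_covBy_of_covBy_sup_left (hy.symm ▸ h))

/-- If `x ⋖ y` is a covering relation in a modular lattice, then every pair in `⌊x → y⌋` is
either an identity relation or a covering relation. -/
theorem tsGen_covBy (L : Type*) [Lattice L] [IsModularLattice L] (x y : L) (h : x ⋖ y) :
    ∀ p ∈ tsGen x y, p.1 = p.2 ∨ p.1 ⋖ p.2 := by
  rintro ⟨a, b⟩ hp
  rcases hp _ ⟨isTransferSystem_restrictions x y, Or.inr ⟨le_rfl, (inf_eq_left.2 h.le).symm⟩⟩ with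
    hab | ⟨hb, hab⟩
  · exact Or.inl hab
  · dsimp only at hb hab ⊢
    exact hab ▸ h.inf_eq_or_inf_covBy hb
end

section
/- Let L be a modular lattice and let x, y ∈ L with x < y. Then the transfer system ⌊x → y⌋ is saturated if and only if y covers x. -/
/-- `⌊x → y⌋` consists of the diagonal together with the restrictions of `x → y`. -/
theorem mem_tsGen_iff {L : Type*} [Lattice L] {x y : L} (h : x ≤ y) (a b : L) :
    (a, b) ∈ tsGen x y ↔ a = b ∨ (b ≤ y ∧ a = x ⊓ b) := by
  constructor
  · intro hab
    refine hab {p : L × L | p.1 = p.2 ∨ (p.2 ≤ y ∧ p.1 = x ⊓ p.2)} ⟨⟨?_, ?_, ?_, ?_⟩, ?_⟩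
    · exact fun _ => Or.inl rfl
    · rintro u v w (huv | ⟨hvy, huv⟩) (hvw | ⟨hwy, hvw⟩) <;> dsimp only at *
      · exact Or.inl (huv.trans hvw)
      · exact Or.inr ⟨hwy, huv.trans hvw⟩
      · subst hvw
        exact Or.inr ⟨hvy, huv⟩
      · refine Or.inr ⟨hwy, ?_⟩
        rw [huv, hvw, ← inf_assoc, inf_idem]
    · rintro u v (huv | ⟨-, huv⟩) <;> dsimp only at *
      · exact huv.le
      · exact huv.trans_le inf_le_right
    · rintro u v w (huv | ⟨hvy, huv⟩) hwv <;> dsimp only at *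
      · subst huv
        exact Or.inl (inf_eq_right.2 hwv)
      · refine Or.inr ⟨hwv.trans hvy, ?_⟩
        change u ⊓ w = x ⊓ w
        rw [huv, inf_assoc, inf_eq_right.2 hwv]
    · exact Or.inr ⟨le_rfl, (inf_eq_left.2 h).symm⟩
  · rintro (rfl | ⟨hby, rfl⟩) T ⟨hT, hxy⟩
    · exact hT.1 a
    · exact hT.2.2.2 x y b hxy hby

theorem isTransferSystem_tsGen {L : Type*} [Lattice L] {x y : L} (h : x ≤ y) :
    IsTransferSystem (tsGen x y) := by
  refine ⟨?_, ?_, ?_, ?_⟩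
  · exact fun u T hT => hT.1.1 u
  · exact fun u v w huv hvw T hT => hT.1.2.1 u v w (huv T hT) (hvw T hT)
  · intro u v huv
    rcases (mem_tsGen_iff h u v).1 huv with huv | ⟨-, huv⟩
    · exact huv.le
    · exact huv.trans_le inf_le_right
  · exact fun u v w huv hwv T hT => hT.1.2.2.2 u v w (huv T hT) hwv

/-- For `x < y` in a modular lattice, `⌊x → y⌋` is saturated iff `y` covers `x`. -/
theorem tsGen_saturated_iff_covBy (L : Type*) [Lattice L] [IsModularLattice L] (x y : L)
    (h : x < y) :
    IsSaturatedTS (tsGen x y) ↔ x ⋖ y := by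
  constructor
  · rintro ⟨-, hsat⟩
    refine ⟨h, fun w hxw hwy => ?_⟩
    have hw := hsat x w y hxw.le hwy.le fun T hT => hT.2
    rcases (mem_tsGen_iff h.le w y).1 hw with rfl | ⟨-, hw⟩
    · exact hwy.false
    · rw [inf_eq_left.2 h.le] at hw
      exact hxw.ne' hw
  · intro hcov
    refine ⟨isTransferSystem_tsGen h.le, fun a b c hab hbc hac => ?_⟩
    rw [mem_tsGen_iff h.le] at hac ⊢
    rcases hac with rfl | ⟨hcy, rfl⟩
    · exact Or.inl (le_antisymm hbc hab)
    rcases hcov.eq_or_eq le_sup_left (sup_le h.le hcy) with hx | hy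
    · rw [inf_eq_right.2 (sup_eq_left.1 hx)] at hab
      exact Or.inl (le_antisymm hbc hab)
    · rw [← hy] at hcov
      rcases (inf_covBy_of_covBy_sup_left hcov).eq_or_eq hab hbc with hb | hb
      · exact Or.inr ⟨hcy, hb⟩
      · exact Or.inl hb
end

section
/- Let L be a lattice and let x, y ∈ L with x ≤ y. Then the right lifting class of the cotransfer system ⌈x → y⌉ equals the right lifting class of the single pair (x, y); that is, ⌈x → y⌉^⧄ = {(x, y)}^⧄. -/
/-- The pairs lifting on the left against a fixed pair `g` form a cotransfer system. -/
theorem isCotransferSystem_setOf_lifts {L : Type*} [Lattice L] (g : L × L) :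
    IsCotransferSystem {f : L × L | f.1 ≤ f.2 ∧ (f.1 ≤ g.1 → f.2 ≤ g.2 → f.2 ≤ g.1)} := by
  refine ⟨fun u => ⟨le_rfl, fun h _ => h⟩, ?_, fun _ _ h => h.1, ?_⟩
  · rintro u v w ⟨huv, hv⟩ ⟨hvw, hw⟩
    exact ⟨huv.trans hvw, fun hu hwg => hw (hv hu (hvw.trans hwg)) hwg⟩
  · rintro u v z ⟨_, hv⟩ huz
    exact ⟨le_sup_right, fun hz hvz =>
      sup_le (hv (huz.trans hz) (le_sup_left.trans hvz)) hz⟩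

/-- The generating pair belongs to the cotransfer system it generates. -/
theorem mem_ctsGen {L : Type*} [Lattice L] (x y : L) : (x, y) ∈ ctsGen x y :=
  fun _ hT => hT.2

/-- `⌈x → y⌉^⧄ = {(x, y)}^⧄`. -/
theorem rlc_ctsGen_eq_rlc_singleton (L : Type*) [Lattice L] (x y : L) (h : x ≤ y) :
    rlc (ctsGen x y) = rlc {((x, y) : L × L)} := by
  ext g
  refine ⟨fun hg => ⟨hg.1, ?_⟩, fun hg => ⟨hg.1, fun f hf => ?_⟩⟩
  · rintro f rfl
    exact hg.2 _ (mem_ctsGen x y)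
  · exact (hf _ ⟨isCotransferSystem_setOf_lifts g, h, hg.2 _ rfl⟩).2
end

section
/- Let L be a lattice with minimum element ⊥ and let x, y ∈ L with x ≤ y. Then the transfer system ⌈x → y⌉^⧄ is saturated if and only if x = ⊥ or x = y. -/
/-- The cotransfer system generated by `x → y` consists of the diagonal and of the pairs
`z → y ⊔ z` with `x ≤ z`. -/
theorem ctsGen_eq {L : Type*} [Lattice L] {x y : L} (h : x ≤ y) :
    ctsGen x y = {p : L × L | p.1 = p.2 ∨ x ≤ p.1 ∧ p.2 = y ⊔ p.1} := by
  apply Set.Subset.antisymm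
  · refine Set.sInter_subset_of_mem ⟨⟨fun a => Or.inl rfl, ?_, ?_, ?_⟩, ?_⟩
    · rintro a b c (hab | ⟨ha, hb⟩) (hbc | ⟨hb', hc⟩) <;> simp_all
    · rintro a b (hab | ⟨-, hb⟩) <;> simp_all
    · rintro a b c (hab | ⟨ha, hb⟩) hac
      · simp_all
      · exact Or.inr ⟨ha.trans hac, by simp_all [sup_assoc]⟩
    · exact Or.inr ⟨le_rfl, (sup_eq_left.2 h).symm⟩
  · rintro ⟨a, b⟩ hab T ⟨hT, hxy⟩
    rcases hab with hab | ⟨ha, hb⟩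
    · dsimp only at hab
      exact hab ▸ hT.1 a
    · dsimp only at ha hb
      exact hb ▸ hT.2.2.2 x y a hxy ha

theorem mem_rlc_ctsGen {L : Type*} [Lattice L] {x y : L} (h : x ≤ y) {a b : L} :
    (a, b) ∈ rlc (ctsGen x y) ↔ a ≤ b ∧ (x ≤ a → y ≤ b → y ≤ a) := by
  rw [ctsGen_eq h]
  refine and_congr_right fun hab => ⟨fun H hx hy => ?_, ?_⟩
  · exact le_sup_left.trans (H (a, y ⊔ a) (Or.inr ⟨hx, rfl⟩) le_rfl (sup_le hy hab))
  · rintro H ⟨z, w⟩ (hzw | ⟨hz, hw⟩) hza hwb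
    · exact hzw ▸ hza
    · dsimp only at hz hw hza hwb ⊢
      subst hw
      exact sup_le (H (hz.trans hza) (le_sup_left.trans hwb)) hza

theorem isTransferSystem_rlc_ctsGen {L : Type*} [Lattice L] {x y : L} (h : x ≤ y) :
    IsTransferSystem (rlc (ctsGen x y)) := by
  simp only [IsTransferSystem, mem_rlc_ctsGen h]
  refine ⟨fun a => ⟨le_rfl, fun _ => id⟩, ?_, fun a b hab => hab.1, ?_⟩
  · rintro a b c ⟨hab, H⟩ ⟨hbc, K⟩
    exact ⟨hab.trans hbc, fun hx hy => H hx (K (hx.trans hab) hy)⟩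
  · rintro a b c ⟨-, H⟩ hcb
    exact ⟨inf_le_right, fun hx hy => le_inf (H (hx.trans inf_le_left) (hy.trans hcb)) hy⟩

/-- `⌈x → y⌉^⧄` is a saturated transfer system iff `x = ⊥` or `x = y`. -/
theorem rlc_ctsGen_saturated_iff (L : Type*) [Lattice L] [OrderBot L] (x y : L) (h : x ≤ y) :
    IsSaturatedTS (rlc (ctsGen x y)) ↔ (x = ⊥ ∨ x = y) := by
  simp only [IsSaturatedTS, isTransferSystem_rlc_ctsGen h, true_and, mem_rlc_ctsGen h]
  constructor
  · intro H
    by_contra! hne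
    have hyx := (H ⊥ x y bot_le h ⟨bot_le, fun hx => (hne.1 (le_bot_iff.1 hx)).elim⟩).2
      le_rfl le_rfl
    exact hne.2 (le_antisymm h hyx)
  · rintro (rfl | rfl) a b c hab hbc ⟨-, H⟩
    · exact ⟨hbc, fun _ hy => (H bot_le hy).trans hab⟩
    · exact ⟨hbc, fun hx _ => hx⟩
end

section
/- Let p be a prime and n a positive natural number. The number of meet-irreducible elements of the lattice Sat(Sub(C_p^n)) of saturated transfer systems on the subgroup lattice of the elementary abelian group C_p^n equals the number of nontrivial subgroups of C_p^n, i.e. equals the sum over i from 1 to n of the number of i-dimensional subspaces of the 𝔽_p-vector space 𝔽_p^n. -/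
section FiniteLattice

variable {L : Type*} [Lattice L]

theorem IsSaturatedTS.inf_mem {T : Set (L × L)} (hT : IsSaturatedTS T) {x y b : L}
    (hx : (x, b) ∈ T) (hy : (y, b) ∈ T) : (x ⊓ y, b) ∈ T :=
  hT.1.2.1 _ y _ (hT.1.2.2.2 x b y hx (hT.1.2.2.1 y b hy)) hy

/-- Each `b` has a least element related to it by a saturated transfer system on a finite
lattice. -/
theorem IsSaturatedTS.exists_least [Finite L] {T : Set (L × L)} (hT : IsSaturatedTS T) (b : L) :
    ∃ m, (m, b) ∈ T ∧ ∀ x, (x, b) ∈ T → m ≤ x := by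
  obtain ⟨m, hm, hmin⟩ := (Set.toFinite {x | (x, b) ∈ T}).exists_minimal ⟨b, hT.1.1 b⟩
  refine ⟨m, hm, fun x hx => ?_⟩
  exact (hmin (hT.inf_mem hm hx) inf_le_left).trans inf_le_right

/-- The elements `y` that are related by `T` to no `x ≠ y`. -/
def fixedPoints (T : Set (L × L)) : Set L := {y | ∀ x, (x, y) ∈ T → x = y}

/-- The relation `a ≤ b` together with `h ≤ b → h ≤ a`. -/
def principalTS (h : L) : Set (L × L) := {q | q.1 ≤ q.2 ∧ (h ≤ q.2 → h ≤ q.1)}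

theorem isSaturatedTS_principalTS (h : L) : IsSaturatedTS (principalTS h) := by
  refine ⟨⟨fun x => ⟨le_rfl, id⟩, fun x y z hxy hyz => ⟨hxy.1.trans hyz.1, hxy.2 ∘ hyz.2⟩,
    fun x y hxy => hxy.1, fun x y z hxy hzy => ⟨inf_le_right, fun hz => ?_⟩⟩,
    fun x y z hxy hyz hxz => ⟨hyz, fun hz => (hxz.2 hz).trans hxy⟩⟩
  exact le_inf (hxy.2 (hz.trans hzy)) hz

theorem IsSaturatedTS.mem_iff [Finite L] {T : Set (L × L)} (hT : IsSaturatedTS T) (a b : L) :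
    (a, b) ∈ T ↔ a ≤ b ∧ ∀ h ∈ fixedPoints T, (a, b) ∈ principalTS h := by
  constructor
  · intro hab
    refine ⟨hT.1.2.2.1 a b hab, fun h hh => ⟨hT.1.2.2.1 a b hab, fun hb => ?_⟩⟩
    exact inf_eq_right.mp (hh _ (hT.1.2.2.2 a b h hab hb))
  · rintro ⟨hab, H⟩
    obtain ⟨m, hm, hmin⟩ := hT.exists_least b
    have hmF : m ∈ fixedPoints T := fun x hx =>
      le_antisymm (hT.1.2.2.1 x m hx) (hmin x (hT.1.2.1 x m b hx hm))
    exact hT.2 m a b ((H m hmF).2 (hT.1.2.2.1 m b hm)) hab hm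

theorem principalTS_bot [OrderBot L] : principalTS (⊥ : L) = {q : L × L | q.1 ≤ q.2} := by
  ext q
  simp [principalTS]

theorem bot_notMem_principalTS [OrderBot L] {h : L} (hh : h ≠ ⊥) : (⊥, h) ∉ principalTS h :=
  fun H => hh (le_bot_iff.mp (H.2 le_rfl))

theorem fixedPoints_principalTS_subset [OrderBot L] (h : L) :
    fixedPoints (principalTS h) ⊆ {⊥, h} := by
  intro b hb
  by_cases hhb : h ≤ b
  · exact Or.inr (hb h ⟨hhb, fun _ => le_rfl⟩).symm
  · exact Or.inl (hb ⊥ ⟨bot_le, fun H => absurd H hhb⟩).symm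

/-- The principal systems are coatoms of the lattice of saturated transfer systems, or its top. -/
theorem IsSaturatedTS.eq_or_eq_of_principalTS_subset [Finite L] [OrderBot L] {h : L}
    {S : Set (L × L)} (hS : IsSaturatedTS S) (hle : principalTS h ⊆ S) :
    S = principalTS h ∨ S = {q : L × L | q.1 ≤ q.2} := by
  have hF : fixedPoints S ⊆ {⊥, h} := fun b hb =>
    fixedPoints_principalTS_subset h fun x hx => hb x (hle hx)
  by_cases hhS : h ∈ fixedPoints S
  · left
    refine Set.Subset.antisymm (fun q hq => ?_) hle
    exact ((hS.mem_iff q.1 q.2).1 hq).2 h hhS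
  · right
    ext ⟨a, b⟩
    refine ⟨fun H => hS.1.2.2.1 a b H, fun H => (hS.mem_iff a b).2 ⟨H, fun k hk => ?_⟩⟩
    rcases hF hk with rfl | rfl
    · exact ⟨H, fun _ => bot_le⟩
    · exact absurd hk hhS

theorem meetIrredSat_principalTS [Finite L] [OrderBot L] {h : L} (hh : h ≠ ⊥) :
    MeetIrredSat (principalTS h) := by
  have hne : principalTS h ≠ {q : L × L | q.1 ≤ q.2} := fun H =>
    bot_notMem_principalTS hh (H ▸ (bot_le : (⊥ : L) ≤ h))
  refine ⟨hne, fun S₁ S₂ h₁ h₂ heq => ?_⟩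
  rcases h₁.eq_or_eq_of_principalTS_subset (heq.subset.trans Set.inter_subset_left) with e₁ | e₁
  · exact Or.inl e₁.symm
  rcases h₂.eq_or_eq_of_principalTS_subset (heq.subset.trans Set.inter_subset_right) with e₂ | e₂
  · exact Or.inr e₂.symm
  · exact absurd (by rw [heq, e₁, e₂, Set.inter_self]) hne

theorem isSaturatedTS_biInter_principalTS (s : Set L) :
    IsSaturatedTS {q : L × L | q.1 ≤ q.2 ∧ ∀ h ∈ s, q ∈ principalTS h} := by
  refine ⟨⟨fun x => ⟨le_rfl, fun h _ => (isSaturatedTS_principalTS h).1.1 x⟩,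
    fun x y z hxy hyz => ⟨hxy.1.trans hyz.1, fun h hh =>
      (isSaturatedTS_principalTS h).1.2.1 x y z (hxy.2 h hh) (hyz.2 h hh)⟩,
    fun x y hxy => hxy.1,
    fun x y z hxy hzy => ⟨inf_le_right, fun h hh =>
      (isSaturatedTS_principalTS h).1.2.2.2 x y z (hxy.2 h hh) hzy⟩⟩,
    fun x y z hxy hyz hxz => ⟨hyz, fun h hh =>
      (isSaturatedTS_principalTS h).2 x y z hxy hyz (hxz.2 h hh)⟩⟩

theorem MeetIrredSat.exists_eq_principalTS_of_finset {T : Set (L × L)} (hT : MeetIrredSat T)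
    (s : Finset L) (hs : T = {q : L × L | q.1 ≤ q.2 ∧ ∀ h ∈ s, q ∈ principalTS h}) :
    ∃ h, T = principalTS h := by
  classical
  induction s using Finset.induction_on with
  | empty => exact absurd (by simpa using hs) hT.1
  | insert k s _ ih =>
    have key : T = principalTS k ∩ {q : L × L | q.1 ≤ q.2 ∧ ∀ h ∈ s, q ∈ principalTS h} := by
      rw [hs]
      ext q
      simp only [Finset.forall_mem_insert, Set.mem_ofPred_eq, Set.mem_inter_iff]
      tauto
    rcases hT.2 _ _ (isSaturatedTS_principalTS k)
      (isSaturatedTS_biInter_principalTS (s : Set L)) key with e | e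
    · exact ⟨k, e⟩
    · exact ih e

theorem exists_eq_principalTS [Finite L] [OrderBot L] {T : Set (L × L)} (hT : IsSaturatedTS T)
    (hirr : MeetIrredSat T) : ∃ h : L, h ≠ ⊥ ∧ principalTS h = T := by
  obtain ⟨h, rfl⟩ := hirr.exists_eq_principalTS_of_finset (Set.toFinite (fixedPoints T)).toFinset
    (by ext ⟨a, b⟩; simpa using hT.mem_iff a b)
  refine ⟨h, ?_, rfl⟩
  rintro rfl
  exact hirr.1 principalTS_bot

theorem le_of_principalTS_eq [OrderBot L] {h k : L} (hh : h ≠ ⊥)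
    (H : principalTS h = principalTS k) : k ≤ h := by
  by_contra hk
  refine bot_notMem_principalTS hh ?_
  rw [H]
  exact ⟨bot_le, fun hkh => absurd hkh hk⟩

/-- On a finite lattice, the meet-irreducible saturated transfer systems are in bijection with the
elements other than the least one. -/
theorem card_meetIrredSat_of_finite [Finite L] [OrderBot L] :
    Nat.card {T : Set (L × L) // IsSaturatedTS T ∧ MeetIrredSat T} =
      Nat.card {h : L // h ≠ ⊥} := by
  symm
  refine Nat.card_congr (Equiv.ofBijective
    (fun h => ⟨principalTS h.1, isSaturatedTS_principalTS h.1, meetIrredSat_principalTS h.2⟩)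
    ⟨fun h k H => ?_, fun T => ?_⟩)
  · have e : principalTS h.1 = principalTS k.1 := congrArg Subtype.val H
    exact Subtype.ext
      (le_antisymm (le_of_principalTS_eq k.2 e.symm) (le_of_principalTS_eq h.2 e))
  · obtain ⟨h, hh, e⟩ := exists_eq_principalTS T.2.1 T.2.2
    exact ⟨⟨h, hh⟩, Subtype.ext e⟩

end FiniteLattice

theorem card_submodule_ne_bot {K V : Type*} [DivisionRing K] [AddCommGroup V] [Module K V]
    [Module.Finite K V] [Finite (Submodule K V)] :
    Nat.card {W : Submodule K V // W ≠ ⊥} =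
      ∑ i ∈ Finset.Icc 1 (Module.finrank K V),
        Nat.card {W : Submodule K V // Module.finrank K W = i} := by
  classical
  have := Fintype.ofFinite (Submodule K V)
  simp only [Nat.card_eq_fintype_card, Fintype.card_subtype]
  rw [Finset.card_eq_sum_card_fiberwise (f := fun W : Submodule K V => Module.finrank K W)
    (t := Finset.Icc 1 (Module.finrank K V))]
  · refine Finset.sum_congr rfl fun i hi => congrArg Finset.card ?_
    ext W
    simp only [Finset.mem_filter, Finset.mem_univ, true_and, and_iff_right_iff_imp]
    rintro rfl rfl
    simp at hi
  · intro W hW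
    have hW' : W ≠ ⊥ := by simpa using hW
    simp only [Finset.coe_Icc, Set.mem_Icc]
    exact ⟨Submodule.one_le_finrank_iff.2 hW', Submodule.finrank_le W⟩

/-- The number of meet-irreducible elements of `Sat(Sub(C_p^n))` equals the number of nontrivial
subgroups of `C_p^n`, i.e. the sum over `i` from `1` to `n` of the number of `i`-dimensional
subspaces of `𝔽_p^n`. -/
theorem card_meetIrred_sat (p n : ℕ) (hp : p.Prime) (hn : 0 < n) :
    Nat.card {T : Set (AddSubgroup (Fin n → ZMod p) × AddSubgroup (Fin n → ZMod p)) //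
        IsSaturatedTS T ∧ MeetIrredSat T} =
      Nat.card {H : AddSubgroup (Fin n → ZMod p) // H ≠ ⊥} ∧
    Nat.card {H : AddSubgroup (Fin n → ZMod p) // H ≠ ⊥} =
      ∑ i ∈ Finset.Icc 1 n,
        Nat.card {W : Submodule (ZMod p) (Fin n → ZMod p) //
          Module.finrank (ZMod p) W = i} := by
  have := Fact.mk hp
  refine ⟨card_meetIrredSat_of_finite, ?_⟩
  rw [Nat.card_congr ((AddSubgroup.toZModSubmodule p
    (M := Fin n → ZMod p)).toEquiv.subtypeEquiv (q := fun W => W ≠ ⊥)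
      fun H => (map_eq_bot_iff (AddSubgroup.toZModSubmodule p)).not.symm)]
  simpa using card_submodule_ne_bot (K := ZMod p) (V := Fin n → ZMod p)
end

section
/- Let p be a prime and n a positive natural number. The number of pairs (A, B) of subspaces of the 𝔽_p-vector space 𝔽_p^n with dim A = 1 and A ⊆ B equals ((p^n − 1)/(p − 1)) · a_{n−1,p}, where a_{n−1,p} denotes the total number of subspaces of 𝔽_p^{n−1}. -/
/-- `a_{m,p}`: the number of `𝔽_p`-linear subspaces of the vector space `𝔽_p^m`. -/
noncomputable def numSubspaces (p m : ℕ) : ℕ :=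
  Nat.card (Submodule (ZMod p) (Fin m → ZMod p))

/-- The subspaces containing a fixed line in a `d + 1`-dimensional space correspond to the
subspaces of `K^d`, by passing to the quotient. -/
noncomputable def iciLineEquivSubmodule {K V : Type*} [Field K] [AddCommGroup V] [Module K V]
    [FiniteDimensional K V] {d : ℕ} (hV : Module.finrank K V = d + 1) (A : Submodule K V)
    (hA : Module.finrank K A = 1) : Set.Ici A ≃ Submodule K (Fin d → K) :=
  have hq : Module.finrank K (V ⧸ A) = Module.finrank K (Fin d → K) := by
    have := A.finrank_quotient_add_finrank
    rw [Module.finrank_fin_fun]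
    lia
  (Submodule.comapMkQRelIso A).toEquiv.symm.trans
    (Submodule.orderIsoMapComap (LinearEquiv.ofFinrankEq (V ⧸ A) (Fin d → K) hq)).toEquiv

/-- Pairs consisting of a line and a subspace containing it, in a `d + 1`-dimensional space,
correspond to pairs of a point of the projective space and a subspace of `K^d`. -/
noncomputable def lineInSubspaceEquiv {K V : Type*} [Field K] [AddCommGroup V] [Module K V]
    [FiniteDimensional K V] {d : ℕ} (hV : Module.finrank K V = d + 1) :
    {q : Submodule K V × Submodule K V // Module.finrank K q.1 = 1 ∧ q.1 ≤ q.2} ≃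
      Projectivization K V × Submodule K (Fin d → K) :=
  calc
    _ ≃ Σ A : {H : Submodule K V // Module.finrank K H = 1}, Set.Ici A.1 :=
      { toFun := fun q => ⟨⟨q.1.1, q.2.1⟩, ⟨q.1.2, q.2.2⟩⟩
        invFun := fun s => ⟨(s.1.1, s.2.1), s.1.2, s.2.2⟩
        left_inv := fun _ => rfl
        right_inv := fun _ => rfl }
    _ ≃ Σ _ : {H : Submodule K V // Module.finrank K H = 1}, Submodule K (Fin d → K) :=
      Equiv.sigmaCongrRight fun A => iciLineEquivSubmodule hV A.1 A.2
    _ ≃ {H : Submodule K V // Module.finrank K H = 1} × Submodule K (Fin d → K) :=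
      Equiv.sigmaEquivProd _ _
    _ ≃ _ := Equiv.prodCongrLeft fun _ => (Projectivization.equivSubmodule K V).symm

/-- The number of pairs `(A, B)` of subspaces of `𝔽_p^n` with `dim A = 1` and `A ⊆ B` equals
`((p^n − 1)/(p − 1)) · a_{n−1,p}`. -/
theorem card_pairs_line_in_subspace (p n : ℕ) (hp : p.Prime) (hn : 0 < n) :
    Nat.card {q : Submodule (ZMod p) (Fin n → ZMod p) × Submodule (ZMod p) (Fin n → ZMod p) //
        Module.finrank (ZMod p) q.1 = 1 ∧ q.1 ≤ q.2} =
      ((p ^ n - 1) / (p - 1)) * numSubspaces p (n - 1) := by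
  have : Fact p.Prime := ⟨hp⟩
  have hV : Module.finrank (ZMod p) (Fin n → ZMod p) = n - 1 + 1 := by
    rw [Module.finrank_fin_fun]
    lia
  rw [Nat.card_congr (lineInSubspaceEquiv hV), Nat.card_prod, Projectivization.card'',
    Nat.card_fun, Nat.card_zmod, Nat.card_fin, numSubspaces]
end

section
/- Let p be a prime and n a natural number, and let a_{m,p} denote the number of subspaces of the 𝔽_p-vector space 𝔽_p^m. Then a_{n+2,p} = 2·a_{n+1,p} + (p^{n+1} − 1)·a_{n,p}. -/
/-- The number of subspaces of a finite-dimensional `𝔽_p`-space depends only on its dimension. -/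
theorem card_submodule_eq_numSubspaces {p m : ℕ} [Fact p.Prime] {V : Type*} [AddCommGroup V]
    [Module (ZMod p) V] [Module.Finite (ZMod p) V] (h : Module.finrank (ZMod p) V = m) :
    Nat.card (Submodule (ZMod p) V) = numSubspaces p m :=
  Nat.card_congr (Submodule.orderIsoMapComap
    (LinearEquiv.ofFinrankEq V (Fin m → ZMod p) (by simpa using h))).toEquiv

/-- The subspaces containing a fixed nonzero vector are counted by the quotient space. -/
theorem card_submodule_mem_eq_numSubspaces {p m : ℕ} [Fact p.Prime] {V : Type*} [AddCommGroup V]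
    [Module (ZMod p) V] [Module.Finite (ZMod p) V] (h : Module.finrank (ZMod p) V = m + 1)
    {v : V} (hv : v ≠ 0) :
    Nat.card {U : Submodule (ZMod p) V // v ∈ U} = numSubspaces p m := by
  have hq : Module.finrank (ZMod p) (V ⧸ Submodule.span (ZMod p) {v}) = m := by
    have := Submodule.finrank_quotient_add_finrank (Submodule.span (ZMod p) {v})
    rw [finrank_span_singleton hv] at this
    omega
  rw [← card_submodule_eq_numSubspaces hq]
  refine Nat.card_congr (Equiv.trans (Equiv.subtypeEquivRight fun U => ?_)
    (Submodule.comapMkQRelIso (Submodule.span (ZMod p) {v})).symm.toEquiv)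
  simp [Submodule.span_singleton_le_iff_mem]

/-- Subspaces of `V × K` that do not contain `(0, 1)` are the graphs of partially defined
functionals on `V`. -/
noncomputable def submoduleNotMemEquivLinearPMap (K V : Type*) [Field K] [AddCommGroup V]
    [Module K V] : {W : Submodule K (V × K) // ((0, 1) : V × K) ∉ W} ≃ (V →ₗ.[K] K) where
  toFun W := W.1.toLinearPMap
  invFun f := ⟨f.graph, fun h => one_ne_zero (f.graph_fst_eq_zero_snd h rfl)⟩
  left_inv W := by
    refine Subtype.ext (Submodule.toLinearPMap_graph_eq _ ?_)
    rintro ⟨x, c⟩ hx (rfl : x = 0)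
    by_contra hc
    refine W.2 ?_
    have := W.1.smul_mem c⁻¹ hx
    simpa [inv_mul_cancel₀ hc] using this
  right_inv f := LinearPMap.eq_of_eq_graph <| Submodule.toLinearPMap_graph_eq _ fun _ hx hx' =>
    f.graph_fst_eq_zero_snd hx hx'

/-- Partially defined functionals are pairs of a domain and a functional on it. -/
def linearPMapEquivSigma (K V : Type*) [Field K] [AddCommGroup V] [Module K V] :
    (V →ₗ.[K] K) ≃ Σ U : Submodule K V, Module.Dual K U where
  toFun f := ⟨f.domain, f.toFun⟩
  invFun f := ⟨f.1, f.2⟩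
  left_inv _ := rfl
  right_inv _ := rfl

/-- Over a finite-dimensional space, partially defined functionals correspond to pairs of a vector
and a subspace containing it. -/
noncomputable def linearPMapEquivSigmaMem (K V : Type*) [Field K] [AddCommGroup V] [Module K V]
    [Module.Finite K V] : (V →ₗ.[K] K) ≃ Σ v : V, {U : Submodule K V // v ∈ U} :=
  (linearPMapEquivSigma K V).trans <|
    (Equiv.sigmaCongrRight fun U : Submodule K V =>
      (Module.finBasis K U).toDualEquiv.symm.toEquiv).trans
    { toFun x := ⟨x.2.1, x.1, x.2.2⟩
      invFun x := ⟨x.2.1, x.1, x.2.2⟩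
      left_inv _ := rfl
      right_inv _ := rfl }

/-- Recursion: `a_{n+2,p} = 2·a_{n+1,p} + (p^{n+1} − 1)·a_{n,p}`. -/
theorem numSubspaces_recursion (p n : ℕ) (hp : p.Prime) :
    numSubspaces p (n + 2) = 2 * numSubspaces p (n + 1) + (p ^ (n + 1) - 1) * numSubspaces p n := by
  classical
  have : Fact p.Prime := ⟨hp⟩
  let V := Fin (n + 1) → ZMod p
  have hX : Module.finrank (ZMod p) (V × ZMod p) = n + 2 := by simp [V]
  have hV : Module.finrank (ZMod p) V = n + 1 := by simp [V]
  have hgraph : Nat.card {W : Submodule (ZMod p) (V × ZMod p) // ((0, 1) : V × ZMod p) ∉ W} =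
      numSubspaces p (n + 1) + (p ^ (n + 1) - 1) * numSubspaces p n := by
    rw [Nat.card_congr ((submoduleNotMemEquivLinearPMap (ZMod p) V).trans
      (linearPMapEquivSigmaMem (ZMod p) V)), Nat.card_sigma,
      ← Finset.add_sum_erase _ _ (Finset.mem_univ (0 : V)),
      Finset.sum_congr rfl fun v hv =>
        card_submodule_mem_eq_numSubspaces hV (Finset.ne_of_mem_erase hv)]
    have hzero : Nat.card {U : Submodule (ZMod p) V // (0 : V) ∈ U} = numSubspaces p (n + 1) :=
      Nat.card_congr (Equiv.subtypeUnivEquiv fun U => U.zero_mem)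
    rw [hzero, Finset.sum_const, Finset.card_erase_of_mem (Finset.mem_univ _), Finset.card_univ]
    simp [V, ZMod.card]
  rw [← card_submodule_eq_numSubspaces hX,
    ← Nat.card_congr (Equiv.sumCompl fun W : Submodule (ZMod p) (V × ZMod p) =>
      ((0, 1) : V × ZMod p) ∈ W), Nat.card_sum, hgraph,
    card_submodule_mem_eq_numSubspaces hX (by simp)]
  ring
end
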